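/- arXiv:1406.5397 — 9 statements merged into one kernel-verified Lean document; each statement's English description precedes it below -/
import Mathlib

section
/- Let p be a prime and let G be a finite p-group that is semi-abelian. Then for every positive integer n, the set Ω_{n}(G) of elements of G of order dividing p^n is a subgroup of G (i.e. the subgroup generated by elements of order dividing p^n consists exactly of the elements of order dividing p^n). -/
/-- `G` is a (strongly) semi-abelian `p`-group, in the sense of M. Y. Xu:
`(x * y⁻¹) ^ p ^ n = 1 ↔ x ^ p ^ n = y ^ p ^ n` for all `x y` and all `n ≥ 1`. -/
def IsSemiAbelian (p : ℕ) (G : Type*) [Group G] : Prop :=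
  ∀ (x y : G) (n : ℕ), 0 < n → ((x * y⁻¹) ^ p ^ n = 1 ↔ x ^ p ^ n = y ^ p ^ n)

/-- In a semi-abelian finite `p`-group, `Ω_n(G)`, the subgroup generated by the
elements of order dividing `p ^ n`, consists exactly of the elements of order
dividing `p ^ n`. -/
theorem omega_eq_of_isSemiAbelian (p : ℕ) (hp : p.Prime) (G : Type*) [Group G] [Finite G]
    (hG : IsPGroup p G) (hsa : IsSemiAbelian p G) (n : ℕ) (hn : 0 < n) (x : G) :
    x ∈ Subgroup.closure {y : G | y ^ p ^ n = 1} ↔ x ^ p ^ n = 1 := by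
  refine ⟨fun hx => ?_, fun hx => Subgroup.subset_closure hx⟩
  induction hx using Subgroup.closure_induction with
  | mem y hy => exact hy
  | one => exact one_pow _
  | mul y z _ _ hy hz =>
    have h := (hsa y z⁻¹ n hn).2 (by rw [hy, inv_pow, hz, inv_one])
    rwa [inv_inv] at h
  | inv y _ hy => rw [inv_pow, hy, inv_one]
end

section
/- Let p be a prime, n a positive integer, and let G be a finite p-group that is semi-abelian. Then the number of distinct p^n-th powers in G equals |G| / |Ω_n(G)|; in particular |G : G^{p^n}| ≤ |Ω_n(G)|, where G^{p^n} is the subgroup generated by all p^n-th powers of elements of G. -/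
/-- In a semi-abelian group the elements of order dividing `p ^ n` form a subgroup. -/
def IsSemiAbelian.omega {p : ℕ} {G : Type*} [Group G] (hsa : IsSemiAbelian p G) {n : ℕ}
    (hn : 0 < n) : Subgroup G :=
  Subgroup.ofDiv {y : G | y ^ p ^ n = 1} ⟨1, one_pow _⟩ fun x hx y hy =>
    (hsa x y n hn).2 (Eq.trans hx (Eq.symm hy))

theorem IsSemiAbelian.mem_omega {p : ℕ} {G : Type*} [Group G] (hsa : IsSemiAbelian p G) {n : ℕ}
    (hn : 0 < n) {x : G} : x ∈ hsa.omega hn ↔ x ^ p ^ n = 1 :=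
  Iff.rfl

theorem IsSemiAbelian.closure_eq_omega {p : ℕ} {G : Type*} [Group G] (hsa : IsSemiAbelian p G)
    {n : ℕ} (hn : 0 < n) : Subgroup.closure {y : G | y ^ p ^ n = 1} = hsa.omega hn :=
  Subgroup.closure_eq (hsa.omega hn)

/-- The fibres of `y ↦ y ^ p ^ n` are the cosets of the subgroup of elements of order dividing
`p ^ n`. -/
theorem IsSemiAbelian.card_range_pow {p : ℕ} {G : Type*} [Group G] (hsa : IsSemiAbelian p G)
    {n : ℕ} (hn : 0 < n) :
    Nat.card (Set.range fun y : G => y ^ p ^ n) = (hsa.omega hn).index := by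
  have h : QuotientGroup.leftRel (hsa.omega hn) = Setoid.ker fun y : G => y ^ p ^ n := by
    ext x y
    rw [QuotientGroup.leftRel_apply, hsa.mem_omega hn, Setoid.ker_def]
    simpa [inv_pow] using hsa x⁻¹ y⁻¹ n hn
  change Nat.card _ = Nat.card (Quotient (QuotientGroup.leftRel (hsa.omega hn)))
  rw [h]
  exact (Nat.card_congr (Setoid.quotientKerEquivRange _)).symm

/-- In a semi-abelian finite `p`-group, the number of distinct `p ^ n`-th powers
`|G^{p^n}|` equals `|G| / |Ω_n(G)|` (so that `|G : G^{\{p^n\}}| = |Ω_n(G)|`),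
and in particular the index of the subgroup `G^{p^n}` generated by the
`p ^ n`-th powers is at most `|Ω_n(G)|`. -/
theorem card_pow_eq_of_isSemiAbelian (p : ℕ) (hp : p.Prime) (G : Type*) [Group G] [Finite G]
    (hG : IsPGroup p G) (hsa : IsSemiAbelian p G) (n : ℕ) (hn : 0 < n) :
    Nat.card (Set.range fun y : G => y ^ p ^ n) =
        Nat.card G / Nat.card (Subgroup.closure {y : G | y ^ p ^ n = 1}) ∧
      (Subgroup.closure (Set.range fun y : G => y ^ p ^ n)).index ≤
        Nat.card (Subgroup.closure {y : G | y ^ p ^ n = 1}) := by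
  rw [hsa.closure_eq_omega hn, hsa.card_range_pow hn]
  have hcard := (hsa.omega hn).card_mul_index
  refine ⟨Nat.eq_div_of_mul_eq_right Nat.card_pos.ne' hcard, ?_⟩
  set K := Subgroup.closure (Set.range fun y : G => y ^ p ^ n)
  have hle : (hsa.omega hn).index ≤ Nat.card K := by
    rw [← hsa.card_range_pow hn]
    exact Nat.card_mono (Set.toFinite (K : Set G)) Subgroup.subset_closure
  refine Nat.le_of_mul_le_mul_right ?_ (Nat.card_pos (α := K))
  calc K.index * Nat.card K = Nat.card G := K.index_mul_card
    _ = Nat.card (hsa.omega hn) * (hsa.omega hn).index := hcard.symm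
    _ ≤ Nat.card (hsa.omega hn) * Nat.card K := Nat.mul_le_mul_left _ hle
end

section
/- Let G be a group and A an abelian normal subgroup of G such that C_G(C_G(A)) = A, where A is regarded as a G-module via conjugation. Let C̃(A) denote the group of automorphisms of G that act trivially on C_G(A) and on G/A. Then there is a group isomorphism from Der(G/C_G(A), A) onto C̃(A) that maps the subgroup Ider(G/C_G(A), A) of inner derivations exactly onto the set of inner automorphisms of G lying in C̃(A). In particular, if every automorphism in C̃(A) is inner, then Ĥ^1(G/C_G(A), A) = 0. -/
/-- `δ : G → G` is a derivation of `G/C_G(A)` with values in the abelian normal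
subgroup `A` (for the conjugation action), viewed as a derivation of `G` with
values in `A` that is trivial on `C_G(A)`. -/
def IsQuotientDerivation (G : Type*) [Group G] (A : Subgroup G) (δ : G → G) : Prop :=
  (∀ x, δ x ∈ A) ∧ (∀ x ∈ Subgroup.centralizer (A : Set G), δ x = 1) ∧
    ∀ x y : G, δ (x * y) = y⁻¹ * δ x * y * δ y

/-- `δ` is the inner derivation `δ_a : x ↦ a⁻¹ * a ^ x` attached to some `a ∈ A`. -/
def IsInnerDerivation (G : Type*) [Group G] (A : Subgroup G) (δ : G → G) : Prop :=
  ∃ a ∈ A, ∀ x : G, δ x = a⁻¹ * (x⁻¹ * a * x)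

namespace IsQuotientDerivation

variable {G : Type*} [Group G] {A : Subgroup G} {δ : G → G}

lemma apply_eq_one (hδ : IsQuotientDerivation G A δ)
    (hab : ∀ a ∈ A, ∀ b ∈ A, a * b = b * a) {a : G} (ha : a ∈ A) : δ a = 1 :=
  hδ.2.1 a (Subgroup.mem_centralizer_iff.mpr fun b hb => hab b hb a ha)

lemma apply_mul_of_mem (hδ : IsQuotientDerivation G A δ)
    (hab : ∀ a ∈ A, ∀ b ∈ A, a * b = b * a) (x : G) {a : G} (ha : a ∈ A) :
    δ (x * a) = δ x := by
  rw [hδ.2.2, hδ.apply_eq_one hab ha, mul_one, mul_assoc, hab _ (hδ.1 x) a ha,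
    inv_mul_cancel_left]

/-- The automorphism `x ↦ x * δ x` attached to a derivation `δ`. -/
def toMulAut (hδ : IsQuotientDerivation G A δ)
    (hab : ∀ a ∈ A, ∀ b ∈ A, a * b = b * a) : MulAut G where
  toFun x := x * δ x
  invFun x := x * (δ x)⁻¹
  left_inv x := by
    beta_reduce
    rw [hδ.apply_mul_of_mem hab x (hδ.1 x), mul_inv_cancel_right]
  right_inv x := by
    beta_reduce
    rw [hδ.apply_mul_of_mem hab x (A.inv_mem (hδ.1 x)), inv_mul_cancel_right]
  map_mul' x y := by
    rw [hδ.2.2]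
    group

/-- An element inducing `x ↦ x * δ x` by conjugation centralizes `C_G(A)`, on which `δ` is
trivial. -/
lemma mem_of_conj (hδ : IsQuotientDerivation G A δ)
    (hcc : Subgroup.centralizer ((Subgroup.centralizer (A : Set G) : Subgroup G) : Set G) = A)
    {g : G} (hg : ∀ x, x * δ x = g⁻¹ * x * g) : g ∈ A := by
  rw [← hcc, Subgroup.mem_centralizer_iff]
  intro c hc
  have h := hg c
  rw [hδ.2.1 c hc, mul_one, mul_assoc, eq_inv_mul_iff_mul_eq] at h
  exact h.symm

lemma isInner_iff_exists_conj [A.Normal] (hδ : IsQuotientDerivation G A δ)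
    (hab : ∀ a ∈ A, ∀ b ∈ A, a * b = b * a)
    (hcc : Subgroup.centralizer ((Subgroup.centralizer (A : Set G) : Subgroup G) : Set G) = A) :
    IsInnerDerivation G A δ ↔ ∃ g : G, ∀ x : G, x * δ x = g⁻¹ * x * g := by
  have hconj (a : G) (ha : a ∈ A) (x : G) : x⁻¹ * a * x ∈ A := by
    simpa using Subgroup.Normal.conj_mem ‹A.Normal› a ha x⁻¹
  constructor
  · rintro ⟨a, ha, h⟩
    refine ⟨a⁻¹, fun x => ?_⟩
    rw [h, hab _ (A.inv_mem ha) _ (hconj a ha x)]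
    group
  · rintro ⟨g, hg⟩
    have hgA := hδ.mem_of_conj hcc hg
    refine ⟨g⁻¹, A.inv_mem hgA, fun x => ?_⟩
    rw [inv_inv, hab _ hgA _ (hconj _ (A.inv_mem hgA) x), eq_inv_mul_of_mul_eq (hg x)]
    group

end IsQuotientDerivation

/-- **Proposition 1.2.** Let `A` be an abelian normal subgroup of `G` with
`C_G(C_G(A)) = A`, and let `C̃(A)` be the group of automorphisms of `G` acting
trivially on `C_G(A)` and on `G/A`.  Then `δ ↦ φ_δ` (`φ_δ x = x * δ x`) is a
group isomorphism from `Der(G/C_G(A), A)` onto `C̃(A)` carrying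
`Ider(G/C_G(A), A)` exactly onto the inner automorphisms lying in `C̃(A)`.
In particular, if `C̃(A) ≤ Inn(G)` then `Ĥ¹(G/C_G(A), A) = 0`, i.e. every
derivation is inner. -/
theorem derivation_equiv_tildeC (G : Type*) [Group G] (A : Subgroup G) [A.Normal]
    (hab : ∀ a ∈ A, ∀ b ∈ A, a * b = b * a)
    (hcc : Subgroup.centralizer ((Subgroup.centralizer (A : Set G) : Subgroup G) : Set G) = A) :
    -- well-definedness: `φ_δ` is an automorphism of `G` acting trivially on
    -- `C_G(A)` and on `G/A`, i.e. `φ_δ ∈ C̃(A)`: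
    (∀ δ : G → G, IsQuotientDerivation G A δ →
      ∃ θ : MulAut G, (∀ x : G, θ x = x * δ x) ∧
        (∀ x ∈ Subgroup.centralizer (A : Set G), θ x = x) ∧
        (∀ x : G, x⁻¹ * θ x ∈ A)) ∧
    -- injectivity:
    (∀ δ δ' : G → G, IsQuotientDerivation G A δ → IsQuotientDerivation G A δ' →
      (∀ x : G, x * δ x = x * δ' x) → δ = δ') ∧
    -- surjectivity onto `C̃(A)`:
    (∀ θ : MulAut G, (∀ x ∈ Subgroup.centralizer (A : Set G), θ x = x) →
      (∀ x : G, x⁻¹ * θ x ∈ A) →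
      ∃ δ : G → G, IsQuotientDerivation G A δ ∧ ∀ x : G, θ x = x * δ x) ∧
    -- multiplicativity: `φ_{δ * δ'} = φ_δ ∘ φ_δ'`:
    (∀ δ δ' : G → G, IsQuotientDerivation G A δ → IsQuotientDerivation G A δ' →
      ∀ x : G, x * (δ x * δ' x) = (x * δ' x) * δ (x * δ' x)) ∧
    -- `Ider` corresponds exactly to the inner automorphisms lying in `C̃(A)`:
    (∀ δ : G → G, IsQuotientDerivation G A δ →
      (IsInnerDerivation G A δ ↔ ∃ g : G, ∀ x : G, x * δ x = g⁻¹ * x * g)) ∧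
    -- in particular, if every automorphism in `C̃(A)` is inner then
    -- `Ĥ¹(G/C_G(A), A) = 0`:
    ((∀ θ : MulAut G, (∀ x ∈ Subgroup.centralizer (A : Set G), θ x = x) →
        (∀ x : G, x⁻¹ * θ x ∈ A) → ∃ g : G, θ = MulAut.conj g) →
      ∀ δ : G → G, IsQuotientDerivation G A δ → IsInnerDerivation G A δ) := by
  refine ⟨fun δ hδ => ⟨hδ.toMulAut hab, fun _ => rfl, fun x hx => ?_, fun x => ?_⟩,
    fun δ δ' _ _ h => funext fun x => mul_left_cancel (h x),
    fun θ hθ hA => ⟨fun x => x⁻¹ * θ x, ⟨hA, fun x hx => ?_, fun x y => ?_⟩, fun x => ?_⟩,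
    fun δ δ' hδ hδ' x => ?_, fun δ hδ => hδ.isInner_iff_exists_conj hab hcc,
    fun h δ hδ => ?_⟩
  · change x * δ x = x
    rw [hδ.2.1 x hx, mul_one]
  · change x⁻¹ * (x * δ x) ∈ A
    simpa using hδ.1 x
  · simp [hθ x hx]
  · simp [mul_assoc]
  · simp
  · rw [hδ.apply_mul_of_mem hab x (hδ'.1 x), hab _ (hδ.1 x) _ (hδ'.1 x), mul_assoc]
  · obtain ⟨g, hg⟩ := h (hδ.toMulAut hab)
      (fun x hx => by change x * δ x = x; rw [hδ.2.1 x hx, mul_one])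
      (fun x => by change x⁻¹ * (x * δ x) ∈ A; simpa using hδ.1 x)
    refine (hδ.isInner_iff_exists_conj hab hcc).mpr ⟨g⁻¹, fun x => ?_⟩
    rw [inv_inv]
    exact DFunLike.congr_fun hg x
end

section
/- Let p be a prime, Q a finite p-group, and A a Q-module whose underlying abelian group is a finite p-group. If Ĥ^n(Q, A) = 0 for some integer n, then A is cohomologically trivial, i.e. Ĥ^k(S, A) = 0 for every subgroup S ≤ Q and every integer k. -/
namespace TateComplex

variable (G : Type*) [Group G] (A : Type*) [CommGroup A] [MulDistribMulAction G A]

/-- The differential `C^k(G,A) → C^{k+1}(G,A)` on inhomogeneous cochains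
(written multiplicatively). -/
noncomputable def dUp (k : ℕ) (f : (Fin k → G) → A) : (Fin (k + 1) → G) → A :=
  fun g =>
    (g 0 • f fun i => g i.succ) *
      ∏ j : Fin (k + 1), f (Fin.contractNth j (· * ·) g) ^ ((-1 : ℤ) ^ ((j : ℕ) + 1))

/-- The norm (trace) map `C_0(G,A) → C^0(G,A)`, both copies of `A`, sending
`a` to `∏_{g ∈ G} g • a`; this is the middle differential of the complete
standard resolution of the finite group `G`. -/
noncomputable def dNorm (f : (Fin 0 → G) → A) : (Fin 0 → G) → A :=
  fun x => ∏ᶠ g : G, g • f x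

/-- The boundary `C_{k+1}(G,A) → C_k(G,A)` on inhomogeneous chains; since `G`
is finite in all our applications, chains in degree `k` are written as functions
`(Fin k → G) → A` (the coefficient function of the corresponding element of
`ℤ[G^k] ⊗ A`). -/
noncomputable def dDown (k : ℕ) (f : (Fin (k + 1) → G) → A) : (Fin k → G) → A :=
  fun h =>
    (∏ᶠ g : G, g⁻¹ • f (Fin.cons g h)) *
      (∏ j : Fin k,
          (∏ᶠ u : G, f (Fin.insertNth j.succ (u⁻¹ * h j) (Function.update h j u))) ^
            ((-1 : ℤ) ^ ((j : ℕ) + 1))) *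
      (∏ᶠ g : G, f (Fin.snoc h g)) ^ ((-1 : ℤ) ^ (k + 1))

/-- `IsZeroH G A n` says that the `n`-th Tate cohomology group `Ĥ^n(G, A)`
vanishes, i.e. that every `n`-cocycle of the complete standard complex of the
finite group `G` is an `n`-coboundary. -/
noncomputable def IsZeroH : ℤ → Prop
  | Int.ofNat 0 => ∀ f, dUp G A 0 f = 1 → ∃ e, dNorm G A e = f
  | Int.ofNat (k + 1) => ∀ f, dUp G A (k + 1) f = 1 → ∃ e, dUp G A k e = f
  | Int.negSucc 0 => ∀ f, dNorm G A f = 1 → ∃ e, dDown G A 0 e = f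
  | Int.negSucc (k + 1) => ∀ f, dDown G A k f = 1 → ∃ e, dDown G A (k + 1) e = f

end TateComplex

/-- If `D` and `T` compose to zero in both orders on a finite submodule `X` and every element of
`X` killed by `D` lies in `T X`, then every element of `X` killed by `T` lies in `D X`
(triviality of the Herbrand quotient of a finite module). -/
theorem Submodule.exists_of_ker_le_range {R V : Type*} [CommRing R] [AddCommGroup V] [Module R V]
    [Finite V] (X : Submodule R V) (D T : Module.End R V)
    (hD : ∀ x ∈ X, D x ∈ X) (hT : ∀ x ∈ X, T x ∈ X)
    (hDT : ∀ x ∈ X, D (T x) = 0) (hTD : ∀ x ∈ X, T (D x) = 0)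
    (h : ∀ x ∈ X, D x = 0 → ∃ y ∈ X, T y = x) :
    ∀ x ∈ X, T x = 0 → ∃ y ∈ X, D y = x := by
  set D' : X →ₗ[R] X := D.restrict hD
  set T' : X →ₗ[R] X := T.restrict hT
  have card (F : X →ₗ[R] X) : Nat.card X = Nat.card F.ker * Nat.card F.range := by
    rw [Submodule.card_eq_card_quotient_mul_card F.ker,
      Nat.card_congr F.quotKerEquivRange.toEquiv]
  have h₁ : D'.ker = T'.range := by
    apply le_antisymm
    · intro x hx
      obtain ⟨y, hy, hyx⟩ := h x x.2 (by simpa [D', Subtype.ext_iff] using hx)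
      exact ⟨⟨y, hy⟩, Subtype.ext hyx⟩
    · rintro _ ⟨y, rfl⟩
      exact Subtype.ext (hDT y y.2)
  have h₂ : D'.range ≤ T'.ker := by
    rintro _ ⟨y, rfl⟩
    exact Subtype.ext (hTD y y.2)
  have h₃ : D'.range = T'.ker := by
    apply SetLike.coe_injective
    refine Set.eq_of_subset_of_ncard_le h₂ ?_ (Set.toFinite _)
    have := (card T').symm.trans (card D')
    rw [h₁, mul_comm] at this
    exact (Nat.eq_of_mul_eq_mul_left Nat.card_pos this).le
  intro x hx hTx
  have : (⟨x, hx⟩ : X) ∈ D'.range := h₃ ▸ Subtype.ext hTx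
  obtain ⟨y, hy⟩ := this
  exact ⟨y, y.2, congrArg Subtype.val hy⟩

/-- An operator of order `p` on a module killed by a power of `p` is unipotent. -/
theorem sub_one_pow_eq_zero_of_pow_prime_eq_one {E : Type*} [Ring E] {p m : ℕ} (hp : p.Prime)
    (hm : (p : E) ^ m = 0) {s : E} (hs : s ^ p = 1) : (s - 1) ^ (p * m) = 0 := by
  obtain ⟨r, hr⟩ := (Commute.one_right (s - 1)).exists_add_pow_prime_eq hp
  have hr' : (s - 1) ^ p = (p : E) * (-((s - 1) * r)) := by
    rw [sub_add_cancel, hs] at hr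
    simp only [one_pow, mul_one] at hr
    have : (s - 1) ^ p = 1 - (1 + p * (s - 1) * r) := by
      rw [eq_sub_iff_add_eq, ← add_assoc, ← hr]
    rw [this]; noncomm_ring
  rw [pow_mul, hr', (Nat.cast_commute p _).mul_pow, hm, zero_mul]

namespace Representation

variable {R G V : Type*} [CommRing R] [Group G] [AddCommGroup V] [Module R V]

/-- Every invariant vector is a norm, i.e. `Ĥ⁰(G, V) = 0`. -/
def NormSurjective [Fintype G] (ρ : Representation R G V) : Prop :=
  ∀ v, (∀ g, ρ g v = v) → ∃ w, ρ.norm w = v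

/-- Every crossed homomorphism is principal, i.e. `Ĥ¹(G, V) = 0`. -/
def CrossedHomPrincipal (ρ : Representation R G V) : Prop :=
  ∀ f : G → V, (∀ g h, f (g * h) = f g + ρ g (f h)) → ∃ v, ∀ g, f g = ρ g v - v

/-- Every vector of norm zero lies in the augmentation submodule, i.e. `Ĥ⁻¹(G, V) = 0`. -/
def NormKerAugmentation [Fintype G] (ρ : Representation R G V) : Prop :=
  ∀ v, ρ.norm v = 0 → v ∈ Coinvariants.ker ρ

section Extension

variable (ρ : Representation R G V) (N : Subgroup G) {σ : G} {p : ℕ}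

/-- The restriction of a representation to a subgroup. -/
abbrev restrict (S : Subgroup G) : Representation R S V := ρ.comp S.subtype

theorem norm_eq_sum_pow_norm [Fintype G] [Fintype N]
    (hbij : Function.Bijective fun x : Fin p × N => σ ^ (x.1 : ℕ) * (x.2 : G)) (v : V) :
    ρ.norm v = (∑ i ∈ Finset.range p, ρ σ ^ i) ((ρ.restrict N).norm v) := by
  calc ρ.norm v = ∑ x : Fin p × N, ρ (σ ^ (x.1 : ℕ) * (x.2 : G)) v := by
        rw [Function.Bijective.sum_comp hbij (fun g => ρ g v), norm, LinearMap.sum_apply]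
    _ = _ := by
        simp [norm, Fintype.sum_prod_type, Finset.sum_range, map_mul, map_pow, map_sum,
          LinearMap.sum_apply]
        exact Finset.sum_comm

theorem geom_sum_sub_one_apply {x : V} (hσ : σ ^ p ∈ N) (hx : ∀ n : N, ρ n x = x) :
    (∑ i ∈ Finset.range p, ρ σ ^ i) ((ρ σ - 1) x) = 0 := by
  rw [← Module.End.mul_apply, geom_sum_mul, ← map_pow]
  simpa [sub_eq_zero] using hx ⟨_, hσ⟩

theorem sub_one_geom_sum_apply {x : V} (hσ : σ ^ p ∈ N) (hx : ∀ n : N, ρ n x = x) :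
    (ρ σ - 1) ((∑ i ∈ Finset.range p, ρ σ ^ i) x) = 0 := by
  rw [← Module.End.mul_apply, mul_geom_sum, ← map_pow]
  simpa [sub_eq_zero] using hx ⟨_, hσ⟩

theorem apply_eq_self_of_bijective
    (hbij : Function.Bijective fun x : Fin p × N => σ ^ (x.1 : ℕ) * (x.2 : G))
    {x : V} (hx : ∀ n : N, ρ n x = x) (hσx : ρ σ x = x) (g : G) : ρ g x = x := by
  obtain ⟨⟨i, n⟩, rfl⟩ := hbij.surjective g
  have (i : ℕ) : (ρ σ ^ i) x = x := by
    induction i with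
    | zero => simp
    | succ i ih => rw [pow_succ, Module.End.mul_apply, hσx, ih]
  simp [map_mul, map_pow, hx, this]

variable [N.Normal]

theorem restrict_apply_of_normal {x : V} (hx : ∀ n : N, ρ n x = x) (g : G) (n : N) :
    ρ n (ρ g x) = ρ g x := by
  have := hx ⟨g⁻¹ * n * g, by simpa using ‹N.Normal›.conj_mem n n.2 g⁻¹⟩
  nth_rewrite 2 [← this]
  rw [← Module.End.mul_apply, ← Module.End.mul_apply, ← map_mul, ← map_mul]
  simp [mul_assoc]

variable [Fintype N]

theorem norm_restrict_apply (g : G) (v : V) :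
    (ρ.restrict N).norm (ρ g v) = ρ g ((ρ.restrict N).norm v) := by
  simp only [norm, LinearMap.sum_apply, map_sum]
  refine Fintype.sum_equiv (MulAut.conjNormal (H := N) g⁻¹).toEquiv _ _ fun n => ?_
  simp only [MonoidHom.comp_apply, ← Module.End.mul_apply, ← map_mul]
  congr 2
  simp [mul_assoc]

variable [Fintype G] [Finite V]

/-- If `Ĥ⁰(G, V) = 0` and `N` is normal with cyclic quotient generated by `σ`, then the elements
of `V ^ N` on which the norm of the quotient vanishes are of the form `σ x - x`. -/
theorem NormSurjective.exists_sub_eq (h : ρ.NormSurjective) (hσ : σ ^ p ∈ N)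
    (hbij : Function.Bijective fun x : Fin p × N => σ ^ (x.1 : ℕ) * (x.2 : G))
    {x : V} (hx : ∀ n : N, ρ n x = x) (hTx : (∑ i ∈ Finset.range p, ρ σ ^ i) x = 0) :
    ∃ y, (∀ n : N, ρ n y = y) ∧ ρ σ y - y = x := by
  have hpow (i : ℕ) (y : V) (hy : ∀ n : N, ρ n y = y) (n : N) :
      ρ n ((ρ σ ^ i) y) = (ρ σ ^ i) y := by
    rw [← map_pow]; exact restrict_apply_of_normal ρ N hy _ _
  obtain ⟨y, hy, hyx⟩ := Submodule.exists_of_ker_le_range (ρ.restrict N).invariants (ρ σ - 1)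
    (∑ i ∈ Finset.range p, ρ σ ^ i)
    (fun y hy n => by
      have := hpow 1 y hy n
      have h2 := hy n
      simp_all)
    (fun y hy n => by
      have := fun i => hpow i y hy n
      simp_all [LinearMap.sum_apply])
    (fun y hy => sub_one_geom_sum_apply ρ N hσ hy)
    (fun y hy => geom_sum_sub_one_apply ρ N hσ hy)
    (fun y hy hDy => by
      obtain ⟨w, hw⟩ := h y
        (apply_eq_self_of_bijective ρ N hbij hy (by simpa [sub_eq_zero] using hDy))
      exact ⟨_, fun n => self_norm_apply (ρ.restrict N) n w,
        by rw [← norm_eq_sum_pow_norm ρ N hbij, hw]⟩) x hx hTx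
  exact ⟨y, hy, by simpa using hyx⟩

/-- If `Ĥ⁰(G, V) = 0` for a `p`-primary `V`, then `Ĥ⁰(N, V) = 0` for `N` normal of index `p`. -/
theorem NormSurjective.restrict (h : ρ.NormSurjective) (hp : p.Prime) {m : ℕ}
    (hV : ∀ v : V, p ^ m • v = 0) (hσ : σ ^ p ∈ N)
    (hbij : Function.Bijective fun x : Fin p × N => σ ^ (x.1 : ℕ) * (x.2 : G)) :
    (ρ.restrict N).NormSurjective := by
  set T := ∑ i ∈ Finset.range p, ρ σ ^ i with hT
  set X := (ρ.restrict N).invariants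
  set Y := LinearMap.range (ρ.restrict N).norm
  have hYX {y : V} (hy : y ∈ Y) : ∀ n : N, ρ n y = y := by
    obtain ⟨w, rfl⟩ := hy
    exact fun n => self_norm_apply (ρ.restrict N) n w
  have hσY {y : V} (hy : y ∈ Y) : ρ σ y ∈ Y := by
    obtain ⟨w, rfl⟩ := hy
    exact ⟨ρ σ w, norm_restrict_apply ρ N σ w⟩
  have hinv {x : V} (hx : ∀ n : N, ρ n x = x) (hDx : ρ σ x - x = 0) : ∃ y ∈ Y, T y = x := by
    obtain ⟨w, hw⟩ := h x (apply_eq_self_of_bijective ρ N hbij hx (sub_eq_zero.1 hDx))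
    exact ⟨_, ⟨w, rfl⟩, by rw [hT, ← norm_eq_sum_pow_norm ρ N hbij, hw]⟩
  have hσpowY (i : ℕ) (y : V) (hy : y ∈ Y) : (ρ σ ^ i) y ∈ Y := by
    induction i with
    | zero => simpa
    | succ i ih => rw [pow_succ', Module.End.mul_apply]; exact hσY ih
  have hTY (y : V) (hy : y ∈ Y) : T y ∈ Y := by
    rw [hT, LinearMap.sum_apply]
    exact Submodule.sum_mem _ fun i _ => hσpowY i y hy
  have hcyc := Submodule.exists_of_ker_le_range Y (ρ σ - 1) T
    (fun y hy => Submodule.sub_mem _ (hσY hy) hy) hTY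
    (fun y hy => sub_one_geom_sum_apply ρ N hσ (hYX hy))
    (fun y hy => geom_sum_sub_one_apply ρ N hσ (hYX hy))
    (fun y hy hDy => hinv (hYX hy) (by simpa using hDy))
  have hdesc {x : V} (hx : ∀ n : N, ρ n x = x) (hDx : (ρ σ - 1) x ∈ Y) : x ∈ Y := by
    obtain ⟨y, hy, hyx⟩ := hcyc _ hDx (geom_sum_sub_one_apply ρ N hσ hx)
    obtain ⟨z, hz, hzx⟩ := hinv (x := x - y)
      (fun n => by rw [map_sub, hx, hYX hy])
      (by
        have : (ρ σ - 1) (x - y) = 0 := by rw [map_sub, hyx, sub_self]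
        simpa using this)
    have hxy : x - y ∈ Y := hzx ▸ hTY z hz
    simpa using Y.add_mem hxy hy
  have hDX : ∀ x ∈ X, (ρ σ - 1) x ∈ X := fun x hx n => by
    have h1 := restrict_apply_of_normal ρ N hx σ n
    have h2 := hx n
    simp_all
  have hunip : ∀ x : V, x ∈ X → ((ρ σ - 1) ^ (p * m)) x = 0 := by
    have hσX : ∀ x ∈ X, ρ σ x ∈ X := fun x hx => restrict_apply_of_normal ρ N hx σ
    have hpX (k : ℕ) (x : X) : ((((ρ σ).restrict hσX) ^ k) x : V) = (ρ σ ^ k) x := by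
      rw [Module.End.pow_restrict]; rfl
    have := sub_one_pow_eq_zero_of_pow_prime_eq_one (E := Module.End R X) (p := p) (m := m)
      (s := (ρ σ).restrict hσX) hp
      (by
        ext x
        rw [← Nat.cast_pow, Module.End.natCast_apply]
        simpa using hV x)
      (by
        ext x
        rw [hpX, ← map_pow]
        exact x.2 ⟨_, hσ⟩)
    intro x hx
    have h2 := congrArg Subtype.val (LinearMap.congr_fun this ⟨x, hx⟩)
    have h3 : (ρ σ).restrict hσX - 1 = (ρ σ - 1).restrict hDX := rfl
    rw [h3, Module.End.pow_restrict] at h2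
    exact h2
  have hall (k : ℕ) : ∀ x ∈ X, ((ρ σ - 1) ^ k) x ∈ Y → x ∈ Y := by
    induction k with
    | zero => simp
    | succ k ih =>
      intro x hx hk
      rw [pow_succ, Module.End.mul_apply] at hk
      exact hdesc hx (ih _ (hDX x hx) hk)
  intro x hx
  exact hall (p * m) x hx (by rw [hunip x hx]; exact Y.zero_mem)

theorem NormSurjective.crossedHomPrincipal (h : ρ.NormSurjective)
    (hN : (ρ.restrict N).CrossedHomPrincipal) (hσ : σ ^ p ∈ N)
    (hbij : Function.Bijective fun x : Fin p × N => σ ^ (x.1 : ℕ) * (x.2 : G)) :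
    ρ.CrossedHomPrincipal := by
  have key (f : G → V) (hf : ∀ g h, f (g * h) = f g + ρ g (f h)) (hfN : ∀ n : N, f n = 0)
      (hfσ : f σ = 0) (g : G) : f g = 0 := by
    obtain ⟨⟨i, n⟩, rfl⟩ := hbij.surjective g
    have (i : ℕ) : f (σ ^ i) = 0 := by
      induction i with
      | zero => simpa using hfN 1
      | succ i ih => rw [pow_succ, hf, ih, hfσ, map_zero, add_zero]
    simp [hf, hfN, this]
  intro f hf
  obtain ⟨a, ha⟩ := hN (fun n => f n) fun g h => hf g h
  have hcob (v : V) (g h : G) :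
      ρ (g * h) v - v = (ρ g v - v) + ρ g (ρ h v - v) := by simp [map_mul]
  set f₁ : G → V := fun g => f g - (ρ g a - a) with hf₁
  have hf₁c (g h) : f₁ (g * h) = f₁ g + ρ g (f₁ h) := by
    simp only [hf₁, hf, hcob, map_sub]; abel
  have hf₁N (n : N) : f₁ n = 0 := by simpa [hf₁, sub_eq_zero] using ha n
  have hinv (g : G) (n : N) : ρ n (f₁ g) = f₁ g := by
    have h1 := hf₁c n g
    have h2 := hf₁c g (g⁻¹ * n * g)
    have h3 := hf₁N ⟨g⁻¹ * n * g, by simpa using ‹N.Normal›.conj_mem n n.2 g⁻¹⟩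
    rw [show f₁ (g⁻¹ * n * g) = 0 from h3, map_zero, add_zero] at h2
    rw [hf₁N, zero_add] at h1
    rw [← h1, ← h2]
    simp [mul_assoc]
  have hpow (i : ℕ) : f₁ (σ ^ i) = (∑ j ∈ Finset.range i, ρ σ ^ j) (f₁ σ) := by
    induction i with
    | zero => simpa using hf₁N 1
    | succ i ih => simp [pow_succ, hf₁c, ih, Finset.sum_range_succ]
  obtain ⟨b, hb, hbσ⟩ := h.exists_sub_eq ρ N hσ hbij (hinv σ)
    (by rw [← hpow]; exact hf₁N ⟨_, hσ⟩)
  refine ⟨a + b, fun g => ?_⟩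
  have := key (fun g => f₁ g - (ρ g b - b))
    (fun g h => by simp only [hf₁c, hcob, map_sub]; abel)
    (fun n => by simp [hf₁N, hb]) (by simp [hbσ]) g
  simp only [hf₁, sub_sub, sub_eq_zero] at this
  rw [this, map_add]; abel

theorem NormSurjective.normKerAugmentation (h : ρ.NormSurjective)
    (hN₀ : (ρ.restrict N).NormSurjective) (hN : (ρ.restrict N).NormKerAugmentation)
    (hσ : σ ^ p ∈ N)
    (hbij : Function.Bijective fun x : Fin p × N => σ ^ (x.1 : ℕ) * (x.2 : G)) :
    ρ.NormKerAugmentation := by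
  intro v hv
  rw [norm_eq_sum_pow_norm ρ N hbij] at hv
  obtain ⟨b, hb, hbσ⟩ := h.exists_sub_eq ρ N hσ hbij
    (fun n => self_norm_apply (ρ.restrict N) n v) hv
  obtain ⟨w, rfl⟩ := hN₀ b hb
  have h1 := hN (v - (ρ σ w - w)) (by rw [map_sub, map_sub, norm_restrict_apply, hbσ, sub_self])
  have h2 : Coinvariants.ker (ρ.restrict N) ≤ Coinvariants.ker ρ := by
    refine Submodule.span_le.2 ?_
    rintro _ ⟨⟨n, x⟩, rfl⟩
    exact Coinvariants.sub_mem_ker (ρ := ρ) (n : G) x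
  simpa using Submodule.add_mem _ (h2 h1) (Coinvariants.sub_mem_ker (ρ := ρ) σ w)

end Extension

/-- In a finite `p`-group every proper subgroup lies in a normal subgroup of index `p`, whose
cosets are represented by powers of a single element. -/
theorem _root_.IsPGroup.exists_normal_le [Finite G] {p : ℕ} [Fact p.Prime] (hG : IsPGroup p G)
    {S : Subgroup G} (hS : S ≠ ⊤) :
    ∃ (N : Subgroup G) (_ : N.Normal) (σ : G), S ≤ N ∧ Nat.card N < Nat.card G ∧ σ ^ p ∈ N ∧
      Function.Bijective fun x : Fin p × N => σ ^ (x.1 : ℕ) * (x.2 : G) := by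
  have hp : p.Prime := Fact.out
  obtain ⟨n, hn⟩ := IsPGroup.iff_card.1 hG
  obtain ⟨s, hs⟩ := IsPGroup.iff_card.1 (hG.to_subgroup S)
  have hlt : p ^ s < p ^ n := by
    rw [← hn, ← hs]
    exact lt_of_le_of_ne (Subgroup.card_le_card_group S)
      fun h => hS (Subgroup.eq_top_of_card_eq S h)
  have hsn := (Nat.pow_lt_pow_iff_right hp.one_lt).1 hlt
  obtain ⟨n, rfl⟩ : ∃ k, n = k + 1 := ⟨n - 1, by omega⟩
  obtain ⟨N, hN, hSN⟩ := Sylow.exists_subgroup_card_pow_prime_le p (n := s) (m := n)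
    (hn ▸ pow_dvd_pow p (Nat.le_succ n)) S hs (by omega)
  have hindex : N.index = p := by
    have := N.card_mul_index
    rw [hN, hn, pow_succ] at this
    exact Nat.eq_of_mul_eq_mul_left (pow_pos hp.pos n) this
  have hnormal : N.Normal := Subgroup.normal_of_index_eq_minFac_card (by
    rw [hindex, hn, hp.pow_minFac (Nat.succ_ne_zero n)])
  have hcard : Nat.card (G ⧸ N) = p := hindex
  obtain ⟨q, hq⟩ : ∃ q : G ⧸ N, q ≠ 1 := by
    have : Nontrivial (G ⧸ N) := Finite.one_lt_card_iff_nontrivial.1 (hcard ▸ hp.one_lt)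
    exact exists_ne 1
  obtain ⟨σ, rfl⟩ := QuotientGroup.mk_surjective q
  have hord : orderOf (σ : G ⧸ N) = p :=
    ((Nat.dvd_prime hp).1 (hcard ▸ orderOf_dvd_natCard _)).resolve_left (by simpa using hq)
  refine ⟨N, hnormal, σ, hSN, ?_, ?_, ?_⟩
  · rw [hN, hn]; exact Nat.pow_lt_pow_right hp.one_lt (Nat.lt_succ_self n)
  · rw [← QuotientGroup.eq_one_iff, QuotientGroup.mk_pow, ← hord, pow_orderOf_eq_one]
  · refine (Nat.bijective_iff_injective_and_card _).2 ⟨?_, ?_⟩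
    · rintro ⟨i, a⟩ ⟨j, b⟩ hab
      have hij : (i : ℕ) = j := by
        have := congrArg (QuotientGroup.mk (s := N)) hab
        simp only [QuotientGroup.mk_mul, QuotientGroup.mk_pow,
          (QuotientGroup.eq_one_iff _).2 a.2, (QuotientGroup.eq_one_iff _).2 b.2, mul_one] at this
        exact pow_injOn_Iio_orderOf (by simp [hord]) (by simp [hord]) this
      obtain rfl := Fin.ext hij
      simpa using hab
    · rw [Nat.card_prod, Nat.card_fin, hN, hn, pow_succ, mul_comm]

theorem NormSurjective.of_mulEquiv {G' : Type*} [Group G'] [Fintype G] [Fintype G']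
    {ρ : Representation R G V} {ρ' : Representation R G' V} (e : G' ≃* G)
    (he : ∀ g, ρ (e g) = ρ' g) (h : ρ.NormSurjective) : ρ'.NormSurjective := by
  intro v hv
  obtain ⟨w, hw⟩ := h v fun g => by rw [← e.apply_symm_apply g, he, hv]
  refine ⟨w, ?_⟩
  rw [← hw, norm, norm, ← Equiv.sum_comp e.toEquiv]
  simp [he]

/-- For a `p`-primary representation of a finite `p`-group, `Ĥ⁰ = 0` implies that `Ĥ⁻¹` and `Ĥ¹`
vanish and that `Ĥ⁰` vanishes for all subgroups. -/
theorem NormSurjective.of_isPGroup {G : Type*} [Group G] [Fintype G] {p : ℕ} [hp : Fact p.Prime]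
    (hG : IsPGroup p G) [Finite V] {m : ℕ} (hV : ∀ v : V, p ^ m • v = 0)
    {ρ : Representation R G V} (h : ρ.NormSurjective) :
    ρ.CrossedHomPrincipal ∧ ρ.NormKerAugmentation ∧
      ∀ (S : Subgroup G) [Fintype S], (ρ.restrict S).NormSurjective := by
  classical
  induction hc : Nat.card G using Nat.strong_induction_on generalizing G with
  | _ c ih =>
    have step {S : Subgroup G} (hS : S ≠ ⊤) [Fintype S] :
        ρ.CrossedHomPrincipal ∧ ρ.NormKerAugmentation ∧ (ρ.restrict S).NormSurjective := by
      obtain ⟨N, _, σ, hSN, hlt, hσ, hbij⟩ := hG.exists_normal_le hS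
      have h₀ := h.restrict ρ N hp.out hV hσ hbij
      obtain ⟨h₁, h₂, h₃⟩ := ih _ (hc ▸ hlt) (hG.to_subgroup N) h₀ rfl
      exact ⟨h.crossedHomPrincipal ρ N h₁ hσ hbij, h.normKerAugmentation ρ N h₀ h₂ hσ hbij,
        (h₃ (S.subgroupOf N)).of_mulEquiv (Subgroup.subgroupOfEquivOfLe hSN).symm
          fun g => by simp⟩
    refine ⟨?_, ?_, fun S _ => ?_⟩
    · rcases subsingleton_or_nontrivial G with hG' | hG'
      · intro f hf
        have h1 : f 1 = 0 := by simpa using hf 1 1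
        exact ⟨0, fun g => by rw [Subsingleton.elim g 1, h1]; simp⟩
      · exact (step (S := ⊥) bot_ne_top).1
    · rcases subsingleton_or_nontrivial G with hG' | hG'
      · intro v hv
        have : v = 0 := by simpa [norm, Fintype.sum_subsingleton _ (1 : G)] using hv
        exact this ▸ Submodule.zero_mem _
      · exact (step (S := ⊥) bot_ne_top).2.1
    · rcases eq_or_ne S ⊤ with rfl | hS
      · exact h.of_mulEquiv Subgroup.topEquiv fun _ => rfl
      · exact (step hS).2.2

end Representation

section TateCohomology

universe u

open CategoryTheory CategoryTheory.Limits

variable {R G : Type u} [CommRing R] [Group G]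

namespace TateCohomology

section Coinduced

variable (A : Rep.{u} R (⊥ : Subgroup G))

/-- A function on `G` is coinduced from the trivial subgroup. -/
def coindMk : (G → A) →ₗ[R] Rep.coind (⊥ : Subgroup G).subtype A :=
  LinearMap.codRestrict _ LinearMap.id fun f s x => by
    rw [Subsingleton.elim s 1]
    simp

variable {A}

theorem coindMk_val (φ : G → A) : (coindMk A φ).1 = φ := rfl

theorem coindMk_surjective : Function.Surjective (coindMk A) := fun φ => ⟨φ.1, rfl⟩

end Coinduced

variable [Fintype G]

theorem isZero_iff (M : Rep.{u} R G) {i j k : ℤ} (hi : i + 1 = j) (hk : j + 1 = k) :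
    IsZero (tateCohomology M j) ↔
      ∀ x : (tateComplex M).X j, (tateComplex M).d j k x = 0 →
        ∃ y : (tateComplex M).X i, (tateComplex M).d i j y = x := by
  change IsZero ((tateComplex M).homology j) ↔ _
  rw [← HomologicalComplex.exactAt_iff_isZero_homology,
    HomologicalComplex.exactAt_iff' _ i j k (by simp [← hi]) (by simp [hk]),
    ShortComplex.moduleCat_exact_iff]
  rfl

theorem d_ofNat (M : Rep.{u} R G) (n : ℕ) :
    (tateComplex M).d (Int.ofNat n) (Int.ofNat (n + 1)) = inhomogeneousCochains.d M n :=
  groupCohomology.inhomogeneousCochains.d_def M n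

theorem d_negSucc (M : Rep.{u} R G) (n : ℕ) :
    (tateComplex M).d (Int.negSucc (n + 1)) (Int.negSucc n) =
      groupHomology.inhomogeneousChains.d M n :=
  groupHomology.inhomogeneousChains.d_def M n

theorem isZero_ofNat_succ_iff (M : Rep.{u} R G) (n : ℕ) :
    IsZero (tateCohomology M (Int.ofNat (n + 1))) ↔
      ∀ f : (Fin (n + 1) → G) → M, inhomogeneousCochains.d M (n + 1) f = 0 →
        ∃ e : (Fin n → G) → M, inhomogeneousCochains.d M n e = f := by
  refine (isZero_iff M (i := Int.ofNat n) (j := Int.ofNat (n + 1)) (k := Int.ofNat (n + 2))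
    rfl rfl).trans ?_
  rw [d_ofNat, d_ofNat]
  rfl

theorem isZero_negSucc_succ_iff (M : Rep.{u} R G) (n : ℕ) :
    IsZero (tateCohomology M (Int.negSucc (n + 1))) ↔
      ∀ f : (Fin (n + 1) → G) →₀ M, groupHomology.inhomogeneousChains.d M n f = 0 →
        ∃ e : (Fin (n + 2) → G) →₀ M, groupHomology.inhomogeneousChains.d M (n + 1) e = f := by
  refine (isZero_iff M (i := Int.negSucc (n + 2)) (j := Int.negSucc (n + 1))
    (k := Int.negSucc n) rfl rfl).trans ?_
  rw [d_negSucc, d_negSucc]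
  rfl

theorem isZero_zero_iff_tateNorm (M : Rep.{u} R G) :
    IsZero (tateCohomology M (Int.ofNat 0)) ↔
      ∀ f : (Fin 0 → G) → M, inhomogeneousCochains.d M 0 f = 0 →
        ∃ e : (Fin 0 → G) →₀ M, M.tateNorm e = f := by
  refine (isZero_iff M (i := Int.negSucc 0) (j := Int.ofNat 0) (k := Int.ofNat 1)
    rfl rfl).trans ?_
  rw [d_ofNat]
  rfl

theorem isZero_neg_one_iff_tateNorm (M : Rep.{u} R G) :
    IsZero (tateCohomology M (Int.negSucc 0)) ↔
      ∀ f : (Fin 0 → G) →₀ M, M.tateNorm f = 0 →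
        ∃ e : (Fin 1 → G) →₀ M, groupHomology.inhomogeneousChains.d M 0 e = f := by
  refine (isZero_iff M (i := Int.negSucc 1) (j := Int.negSucc 0) (k := Int.ofNat 0)
    rfl rfl).trans ?_
  rw [d_negSucc]
  rfl

theorem tateNorm_apply (M : Rep.{u} R G) (f : (Fin 0 → G) →₀ M) (x : Fin 0 → G) :
    (M.tateNorm f : (Fin 0 → G) → M) x = M.ρ.norm (f default) := by
  rw [Rep.tateNorm_eq]
  nth_rewrite 1 [Finsupp.unique_single f]
  change (Finsupp.lsum R (fun _ : Fin 0 → G ↦ LinearMap.pi fun _ : Fin 0 → G ↦ M.ρ.norm)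
    (Finsupp.single default (f default))) x = _
  simp

theorem isZero_zero_iff (M : Rep.{u} R G) :
    IsZero (tateCohomology M (Int.ofNat 0)) ↔ M.ρ.NormSurjective := by
  rw [isZero_zero_iff_tateNorm]
  have hd (f : (Fin 0 → G) → M) :
      inhomogeneousCochains.d M 0 f = 0 ↔ ∀ g, M.ρ g (f default) = f default := by
    have h1 (g : Fin 1 → G) :
        inhomogeneousCochains.d M 0 f g = M.ρ (g 0) (f default) - f default := by
      refine (inhomogeneousCochains.d_hom_apply M 0 f g).trans ?_
      rw [Fin.sum_univ_one, Subsingleton.elim (fun i : Fin 0 => g i.succ) default,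
        Subsingleton.elim (Fin.contractNth _ _ _ : Fin 0 → G) default]
      simp [← sub_eq_add_neg]
    refine ⟨fun h g => sub_eq_zero.1 ((h1 fun _ => g).symm.trans (congrFun h _)),
      fun h => funext fun g => (h1 g).trans (sub_eq_zero.2 (h _))⟩
  constructor
  · intro h v hv
    obtain ⟨e, he⟩ := h (fun _ => v) ((hd _).2 hv)
    exact ⟨e default, by rw [← tateNorm_apply M e default, he]⟩
  · intro h f hf
    obtain ⟨w, hw⟩ := h _ ((hd f).1 hf)
    refine ⟨Finsupp.single default w, funext fun x => ?_⟩
    rw [tateNorm_apply, Finsupp.single_eq_same, hw, Unique.eq_default x]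

theorem isZero_one_of_crossedHomPrincipal (M : Rep.{u} R G) (h : M.ρ.CrossedHomPrincipal) :
    IsZero (tateCohomology M (Int.ofNat 1)) := by
  rw [isZero_ofNat_succ_iff]
  intro f hf
  obtain ⟨v, hv⟩ := h (fun g => f fun _ => g) fun g h => by
    have e1 : (fun i : Fin 1 => (![g, h] : Fin 2 → G) i.succ) = fun _ => h := by
      funext i; fin_cases i; rfl
    have e2 : Fin.contractNth (0 : Fin 2) (· * ·) ![g, h] = fun _ => g * h := by
      funext i; fin_cases i; rfl
    have e3 : Fin.contractNth (1 : Fin 2) (· * ·) ![g, h] = fun _ => g := by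
      funext i; fin_cases i; rfl
    have := (inhomogeneousCochains.d_hom_apply M 1 f ![g, h]).symm.trans (congrFun hf ![g, h])
    rw [Fin.sum_univ_two, e1, e2, e3] at this
    simp only [Matrix.cons_val_zero, Fin.val_zero, zero_add, pow_one, neg_smul, one_smul,
      Fin.val_one, one_add_one_eq_two, even_two.neg_one_pow] at this
    replace this : M.ρ g (f fun _ => h) + ((-f fun _ => g * h) + f fun _ => g) = 0 := this
    rw [← sub_eq_zero, ← neg_eq_zero, ← this]
    abel
  refine ⟨fun _ => v, funext fun g => ?_⟩
  have hg : (fun _ => g 0) = g := funext fun i => by rw [Fin.eq_zero i]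
  have := (hv (g 0)).symm
  rw [hg] at this
  refine (inhomogeneousCochains.d_hom_apply M 0 _ g).trans ?_
  rw [Fin.sum_univ_one, ← this]
  simp [sub_eq_add_neg]

theorem isZero_neg_one_of_normKerAugmentation (M : Rep.{u} R G) (h : M.ρ.NormKerAugmentation) :
    IsZero (tateCohomology M (Int.negSucc 0)) := by
  rw [isZero_neg_one_iff_tateNorm]
  intro f hf
  have hv := h (f default) (by rw [← tateNorm_apply M f default, hf]; rfl)
  have hle : Representation.Coinvariants.ker M.ρ ≤
      (LinearMap.range (groupHomology.inhomogeneousChains.d M 0).hom).comap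
        (Finsupp.lsingle default) := by
    refine Submodule.span_le.2 ?_
    rintro _ ⟨⟨g, x⟩, rfl⟩
    refine ⟨Finsupp.single (fun _ => g⁻¹) x, ?_⟩
    refine (groupHomology.inhomogeneousChains.d_single 0 _ x).trans ?_
    rw [Fin.sum_univ_one, Subsingleton.elim (fun i : Fin 0 => g⁻¹) default,
      Subsingleton.elim (Fin.contractNth _ _ _ : Fin 0 → G) default]
    simp [sub_eq_add_neg]
  obtain ⟨e, he⟩ := hle hv
  exact ⟨e, he.trans (Finsupp.unique_single f).symm⟩

section Acyclic

variable {A : Rep.{u} R (⊥ : Subgroup G)}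

theorem norm_coind_val (φ : Rep.coind (⊥ : Subgroup G).subtype A) (x : G) :
    ((Rep.coind (⊥ : Subgroup G).subtype A).ρ.norm φ).1 x = ∑ g, φ.1 g := by
  have h : ((Rep.coind (⊥ : Subgroup G).subtype A).ρ.norm φ).1 x = ∑ g, φ.1 (x * g) := by
    simp only [Representation.norm, LinearMap.sum_apply, AddSubmonoidClass.coe_finsetSum,
      Finset.sum_apply]
    rfl
  rw [h]
  exact Equiv.sum_comp (Equiv.mulLeft x) φ.1

theorem normSurjective_coind :
    (Rep.coind (⊥ : Subgroup G).subtype A).ρ.NormSurjective := by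
  classical
  intro φ hφ
  have hc (x : G) : φ.1 x = φ.1 1 := by
    have := congrFun (congrArg Subtype.val (hφ x)) 1
    rw [← this]
    exact congrArg φ.1 (one_mul x).symm
  refine ⟨coindMk A (Pi.single 1 (φ.1 1)), Subtype.ext (funext fun x => ?_)⟩
  rw [norm_coind_val, coindMk_val, hc x]
  simp [Pi.single_apply]

theorem normKerAugmentation_coind :
    (Rep.coind (⊥ : Subgroup G).subtype A).ρ.NormKerAugmentation := by
  classical
  intro φ hφ
  have h0 : ∑ g, φ.1 g = 0 := by
    rw [← norm_coind_val φ 1, hφ]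
    rfl
  have h1 : ∑ x, ((Rep.coind (⊥ : Subgroup G).subtype A).ρ x⁻¹ (coindMk A (Pi.single 1 (φ.1 x))) -
      coindMk A (Pi.single 1 (φ.1 x))) = φ := by
    have h2 : ∑ x, coindMk A (Pi.single 1 (φ.1 x)) = 0 := by
      have h3 := map_sum (coindMk A ∘ₗ LinearMap.single R (fun _ : G => A) 1) φ.1 Finset.univ
      rw [h0, map_zero] at h3
      exact h3.symm
    rw [Finset.sum_sub_distrib, h2, sub_zero]
    refine Subtype.ext (funext fun y => ?_)
    simp only [AddSubmonoidClass.coe_finsetSum, Finset.sum_apply]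
    rw [Finset.sum_eq_single y]
    · change Pi.single (M := fun _ => A.V) 1 (φ.1 y) (y * y⁻¹) = _
      simp
    · intro x _ hx
      change Pi.single (M := fun _ => A.V) 1 (φ.1 x) (y * x⁻¹) = _
      rw [Pi.single_eq_of_ne]
      rwa [Ne, mul_inv_eq_one, eq_comm]
    · simp
  rw [← h1]
  exact Submodule.sum_mem _ fun x _ => Representation.Coinvariants.sub_mem_ker _ _

theorem isZero_coind (n : ℤ) :
    IsZero (tateCohomology (Rep.coind (⊥ : Subgroup G).subtype A) n) := by
  classical
  match n with
  | Int.ofNat 0 => exact (isZero_zero_iff _).2 normSurjective_coind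
  | Int.ofNat (n + 1) =>
    exact ((isZero_groupCohomology_succ_of_subsingleton A n).of_iso
      (groupCohomology.coindIso A (n + 1))).of_iso ((isoGroupCohomology (n + 1)).app _)
  | Int.negSucc 0 => exact isZero_neg_one_of_normKerAugmentation _ normKerAugmentation_coind
  | Int.negSucc (n + 1) =>
    exact (((isZero_groupHomology_succ_of_subsingleton A n).of_iso
      (groupHomology.indIso ⊥ A (n + 1))).of_iso ((groupHomology.functor R G (n + 1)).mapIso
        (Rep.indCoindIso A).symm)).of_iso
        ((isoGroupHomology (Int.negSucc (n + 1)) (n + 1) rfl).app _)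

end Acyclic

theorem isZero_shift {X Y Z : Rep.{u} R G} {f : X ⟶ Y} {g : Y ⟶ Z} {w : f ≫ g = 0}
    (hS : (ShortComplex.mk f g w).ShortExact)
    (h : ∀ n, IsZero (tateCohomology Y n)) (n : ℤ) :
    IsZero (tateCohomology Z n) ↔ IsZero (tateCohomology X (n + 1)) :=
  ((map_tateComplexFunctor_shortExact hS).δIso n (n + 1) rfl (h n) (h (n + 1))).isZero_iff

/-- The embedding of a representation into the functions on `G`. -/
def toCoind (M : Rep.{u} R G) :
    M ⟶ Rep.coind (⊥ : Subgroup G).subtype (Rep.res (⊥ : Subgroup G).subtype M) :=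
  Rep.resCoindToHom (⊥ : Subgroup G).subtype M _ (𝟙 _)

instance (M : Rep.{u} R G) : Mono (toCoind M) :=
  (Rep.mono_iff_injective _).2 fun x y h => by
    have h1 (z : M) : (toCoind M z).1 1 = z := by
      change M.ρ 1 z = z
      simp
    rw [← h1 x, ← h1 y]
    exact congrFun (congrArg Subtype.val h) 1

/-- The projection of the functions on `G` onto a representation. -/
def ofCoind (M : Rep.{u} R G) :
    Rep.coind (⊥ : Subgroup G).subtype (Rep.res (⊥ : Subgroup G).subtype M) ⟶ M :=
  Rep.ofHom (LinearMap.intertwiningMap_of_isIntertwiningMap _ _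
    (∑ x : G, M.ρ x⁻¹ ∘ₗ LinearMap.proj x ∘ₗ Submodule.subtype _) fun g φ => by
      simp only [LinearMap.sum_apply, map_sum]
      rw [← Equiv.sum_comp (Equiv.mulRight g⁻¹)]
      refine Finset.sum_congr rfl fun x _ => ?_
      change M.ρ (x * g⁻¹)⁻¹ (φ.1 (x * g⁻¹ * g)) = M.ρ g (M.ρ x⁻¹ (φ.1 x))
      rw [inv_mul_cancel_right, mul_inv_rev, inv_inv, map_mul, Module.End.mul_apply])

theorem ofCoind_apply (M : Rep.{u} R G)
    (φ : Rep.coind (⊥ : Subgroup G).subtype (Rep.res (⊥ : Subgroup G).subtype M)) :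
    (ofCoind M).hom φ = ∑ x : G, M.ρ x⁻¹ (φ.1 x) :=
  LinearMap.sum_apply _ _ _

instance (M : Rep.{u} R G) : Epi (ofCoind M) :=
  (Rep.epi_iff_surjective _).2 fun m => by
    classical
    refine ⟨coindMk _ (Pi.single 1 m), ?_⟩
    rw [ofCoind_apply, Finset.sum_eq_single 1]
    · change M.ρ 1⁻¹ (Pi.single (M := fun _ : G => M.V) 1 m 1) = m
      simp
    · intro x _ hx
      change M.ρ x⁻¹ (Pi.single (M := fun _ => M.V) 1 m x) = 0
      simp [hx]
    · simp

/-- Dimension shifting along the embedding of a representation into the functions on `G`. -/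
theorem exists_shift_up (M : Rep.{u} R G) : ∃ (N : Rep.{u} R G)
    (π : (G → M) →ₗ[R] N), Function.Surjective π ∧
      ∀ n, IsZero (tateCohomology N n) ↔ IsZero (tateCohomology M (n + 1)) := by
  have hS : (ShortComplex.mk _ _ (cokernel.condition (toCoind M))).ShortExact :=
    .mk' (ShortComplex.exact_cokernel (toCoind M)) inferInstance inferInstance
  have hπ := (Rep.epi_iff_surjective (cokernel.π (toCoind M))).1 inferInstance
  refine ⟨cokernel (toCoind M), (cokernel.π (toCoind M)).hom.toLinearMap ∘ₗ
    coindMk (Rep.res (⊥ : Subgroup G).subtype M),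
    ?_, isZero_shift hS fun n => isZero_coind n⟩
  exact hπ.comp (coindMk_surjective (A := Rep.res (⊥ : Subgroup G).subtype M))

/-- Dimension shifting along the projection of the functions on `G` onto a representation. -/
theorem exists_shift_down (M : Rep.{u} R G) : ∃ (N : Rep.{u} R G)
    (ι : N →ₗ[R] (G → M)), Function.Injective ι ∧
      ∀ n, IsZero (tateCohomology M n) ↔ IsZero (tateCohomology N (n + 1)) := by
  have hS : (ShortComplex.mk _ _ (kernel.condition (ofCoind M))).ShortExact :=
    .mk' (ShortComplex.exact_kernel (ofCoind M)) inferInstance inferInstance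
  have hι := (Rep.mono_iff_injective (kernel.ι (ofCoind M))).1 inferInstance
  exact ⟨kernel (ofCoind M), Submodule.subtype _ ∘ₗ (kernel.ι (ofCoind M)).hom.toLinearMap,
    Subtype.val_injective.comp hι, isZero_shift hS fun n => isZero_coind n⟩

variable {p m : ℕ} [Fact p.Prime]

theorem isZero_one_and_neg_one (hG : IsPGroup p G) (M : Rep.{u} R G) [Finite M]
    (hM : ∀ v : M, p ^ m • v = 0) (h : IsZero (tateCohomology M 0)) :
    IsZero (tateCohomology M 1) ∧ IsZero (tateCohomology M (-1)) := by
  obtain ⟨h1, h2, -⟩ := Representation.NormSurjective.of_isPGroup hG hM ((isZero_zero_iff M).1 h)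
  exact ⟨isZero_one_of_crossedHomPrincipal M h1, isZero_neg_one_of_normKerAugmentation M h2⟩

theorem isZero_succ_and_pred (hG : IsPGroup p G) (n : ℤ) : ∀ (M : Rep.{u} R G) [Finite M],
    (∀ v : M, p ^ m • v = 0) → IsZero (tateCohomology M n) →
    IsZero (tateCohomology M (n + 1)) ∧ IsZero (tateCohomology M (n - 1)) := by
  induction n with
  | zero => exact fun M _ hM h => isZero_one_and_neg_one hG M hM h
  | succ n ih =>
    intro M _ hM h
    obtain ⟨N, π, hπ, hN⟩ := exists_shift_up M
    have := Finite.of_surjective π hπ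
    have hN' : ∀ v : N, p ^ m • v = 0 := fun v => by
      obtain ⟨φ, rfl⟩ := hπ v
      rw [← map_nsmul, show p ^ m • φ = 0 from funext fun x => hM _, map_zero]
    obtain ⟨h1, h2⟩ := ih N hN' ((hN _).2 h)
    refine ⟨(hN _).1 h1, ?_⟩
    have := (hN _).1 h2
    rwa [sub_add_cancel, ← add_sub_cancel_right (n : ℤ) 1] at this
  | pred n ih =>
    intro M _ hM h
    obtain ⟨N, ι, hι, hN⟩ := exists_shift_down M
    have := Finite.of_injective ι hι
    have hN' : ∀ v : N, p ^ m • v = 0 := fun v => hι <| by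
      rw [map_nsmul, map_zero]
      exact funext fun x => hM _
    have h0 := (hN _).1 h
    rw [sub_add_cancel] at h0
    obtain ⟨h1, h2⟩ := ih N hN' h0
    refine ⟨(hN _).2 ?_, (hN _).2 ?_⟩
    · rwa [sub_add_cancel]
    · rwa [sub_add_cancel]

theorem isZero_of_isZero (hG : IsPGroup p G) (M : Rep.{u} R G) [Finite M]
    (hM : ∀ v : M, p ^ m • v = 0) {n : ℤ} (h : IsZero (tateCohomology M n)) (k : ℤ) :
    IsZero (tateCohomology M k) :=
  Int.inductionOn' k n h (fun k _ hk => (isZero_succ_and_pred hG k M hM hk).1)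
    fun k _ hk => (isZero_succ_and_pred hG k M hM hk).2

theorem isZero_res_of_isZero (hG : IsPGroup p G) (M : Rep.{u} R G) [Finite M]
    (hM : ∀ v : M, p ^ m • v = 0) {n : ℤ} (h : IsZero (tateCohomology M n))
    (S : Subgroup G) [Fintype S] (k : ℤ) :
    IsZero (tateCohomology (Rep.of (M.ρ.restrict S)) k) := by
  have h0 : M.ρ.NormSurjective := (isZero_zero_iff M).1 (isZero_of_isZero hG M hM h 0)
  exact isZero_of_isZero (hG.to_subgroup S) _ hM
    ((isZero_zero_iff _).2 ((Representation.NormSurjective.of_isPGroup hG hM h0).2.2 S)) k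

end TateCohomology

end TateCohomology

theorem exact_iff_of_equiv {X Y Z X' Y' Z' : Type*} (eX : X ≃ X') (eY : Y ≃ Y') (eZ : Z ≃ Z')
    {d : X → Y} {δ : Y → Z} {d' : X' → Y'} {δ' : Y' → Z'} {z : Z} {z' : Z'}
    (hd : ∀ x, d' (eX x) = eY (d x)) (hδ : ∀ y, δ' (eY y) = eZ (δ y)) (hz : eZ z = z') :
    (∀ y, δ y = z → ∃ x, d x = y) ↔ ∀ y, δ' y = z' → ∃ x, d' x = y := by
  rw [← eY.forall_congr_right]
  refine forall_congr' fun y => ?_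
  rw [hδ, ← hz, eZ.apply_eq_iff_eq, ← eX.exists_congr_right]
  simp only [hd, eY.apply_eq_iff_eq]

theorem Finset.sum_single_apply_of_section {X Y U B : Type*} [Fintype X] [Fintype U]
    [AddCommMonoid B] {φ : X → Y} {y : Y} (c : U → X) (r : X → U) (hc : ∀ u, φ (c u) = y)
    (hr : ∀ u, r (c u) = u) (hcr : ∀ x, φ x = y → c (r x) = x) (F : X → B) :
    ∑ x, Finsupp.single (φ x) (F x) y = ∑ u, F (c u) := by
  classical
  simp only [Finsupp.single_apply]
  rw [← Finset.sum_filter]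
  refine Finset.sum_nbij' r c (by simp) (by simpa using hc) ?_ (by simpa using hr) ?_
  · intro x hx
    exact hcr x (Finset.mem_filter.1 hx).2
  · intro x hx
    rw [hcr x (Finset.mem_filter.1 hx).2]

namespace Fin

variable {G : Type*} [Group G] {n : ℕ}

theorem contractNth_castSucc_insertNth (j : Fin n) (h : Fin n → G) (u : G) :
    contractNth j.castSucc (· * ·)
      (insertNth j.succ (u⁻¹ * h j) (Function.update h j u) : Fin (n + 1) → G) = h := by
  funext i
  rcases lt_trichotomy i j with hij | rfl | hij
  · rw [contractNth_apply_of_lt _ _ _ _ (by simpa using hij),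
      ← succAbove_of_castSucc_lt j.succ i (castSucc_lt_succ_iff.2 hij.le), insertNth_apply_succAbove,
      Function.update_of_ne hij.ne]
  · rw [contractNth_apply_of_eq _ _ _ _ (by simp), insertNth_apply_same]
    nth_rewrite 1 [← succAbove_of_castSucc_lt i.succ i castSucc_lt_succ]
    rw [insertNth_apply_succAbove, Function.update_self, mul_inv_cancel_left]
  · rw [contractNth_apply_of_gt _ _ _ _ (by simpa using hij),
      ← succAbove_of_le_castSucc j.succ i (succ_le_castSucc_iff.2 hij), insertNth_apply_succAbove,
      Function.update_of_ne hij.ne']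

theorem insertNth_contractNth_castSucc (j : Fin n) (x : Fin (n + 1) → G) :
    (insertNth j.succ ((x j.castSucc)⁻¹ * contractNth j.castSucc (· * ·) x j)
      (Function.update (contractNth j.castSucc (· * ·) x) j (x j.castSucc)) : Fin (n + 1) → G) =
      x := by
  rw [insertNth_eq_iff]
  refine ⟨?_, funext fun i => ?_⟩
  · rw [contractNth_apply_of_eq _ _ _ _ (by simp), inv_mul_cancel_left]
  · rw [removeNth_apply]
    rcases lt_trichotomy i j with hij | rfl | hij
    · rw [Function.update_of_ne hij.ne, contractNth_apply_of_lt _ _ _ _ (by simpa using hij),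
        succAbove_of_castSucc_lt j.succ i (castSucc_lt_succ_iff.2 hij.le)]
    · rw [Function.update_self, succAbove_of_castSucc_lt i.succ i castSucc_lt_succ]
    · rw [Function.update_of_ne hij.ne', contractNth_apply_of_gt _ _ _ _ (by simpa using hij),
        succAbove_of_le_castSucc j.succ i (succ_le_castSucc_iff.2 hij)]

theorem contractNth_last (x : Fin (n + 1) → G) :
    contractNth (last n) (· * ·) x = init x := by
  funext i
  rw [contractNth_apply_of_lt _ _ _ _ (by simp), init]

end Fin

namespace TateComplex

universe u

open CategoryTheory CategoryTheory.Limits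

variable (G A : Type u) [Group G] [CommGroup A] [MulDistribMulAction G A]

/-- The representation on the additive group of a multiplicative module. -/
def rep : Rep.{u} (ULift.{u} ℤ) G :=
  Rep.of (X := Additive A)
    { toFun := fun g =>
        { toFun := fun a => Additive.ofMul (g • a.toMul)
          map_add' := fun a b => congrArg Additive.ofMul (smul_mul' g a.toMul b.toMul)
          map_smul' := fun r a => congrArg Additive.ofMul (smul_zpow' g a.toMul r.down) }
      map_one' := LinearMap.ext fun a => congrArg Additive.ofMul (one_smul G a.toMul)
      map_mul' := fun g h => LinearMap.ext fun a =>
        congrArg Additive.ofMul (mul_smul g h a.toMul) }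

variable {G A}

/-- Multiplicative cochains as additive cochains. -/
def cochainEquiv (k : ℕ) : ((Fin k → G) → A) ≃ ((Fin k → G) → rep G A) :=
  Equiv.refl _

theorem d_cochainEquiv (k : ℕ) (f : (Fin k → G) → A) :
    inhomogeneousCochains.d (rep G A) k (cochainEquiv k f) =
      cochainEquiv (k + 1) (dUp G A k f) := by
  funext g
  refine (inhomogeneousCochains.d_hom_apply (rep G A) k _ g).trans ?_
  change _ = Additive.ofMul (dUp G A k f g)
  rw [dUp, ofMul_mul, ofMul_prod]
  rfl

/-- Multiplicative chains as additive chains. -/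
noncomputable def chainEquiv [Finite G] (k : ℕ) : ((Fin k → G) → A) ≃ ((Fin k → G) →₀ rep G A) :=
  (cochainEquiv k).trans Finsupp.equivFunOnFinite.symm

theorem tateNorm_chainEquiv [Fintype G] (f : (Fin 0 → G) → A) :
    (rep G A).tateNorm (chainEquiv 0 f) = cochainEquiv 0 (dNorm G A f) := by
  funext x
  rw [TateCohomology.tateNorm_apply, Representation.norm, LinearMap.sum_apply,
    Subsingleton.elim default x]
  change _ = Additive.ofMul (dNorm G A f x)
  rw [dNorm, finprod_eq_prod_of_fintype, ofMul_prod]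
  rfl

theorem chainEquiv_eq_sum [Fintype G] (k : ℕ) (f : (Fin k → G) → A) :
    chainEquiv k f = ∑ g, Finsupp.single g (cochainEquiv k f g) := by
  classical
  refine Finsupp.ext fun h => ?_
  rw [Finsupp.finsetSum_apply]
  simp only [Finsupp.single_apply, Finset.sum_ite_eq', Finset.mem_univ, if_true]
  rfl

theorem d_chainEquiv [Fintype G] (k : ℕ) (f : (Fin (k + 1) → G) → A) :
    groupHomology.inhomogeneousChains.d (rep G A) k (chainEquiv (k + 1) f) =
      chainEquiv k (dDown G A k f) := by
  rw [chainEquiv_eq_sum, map_sum]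
  refine Finsupp.ext fun h => ?_
  rw [Finsupp.finsetSum_apply]
  have hD : chainEquiv k (dDown G A k f) h =
      ∑ u : G, (rep G A).ρ u⁻¹ (cochainEquiv (k + 1) f (Fin.cons u h)) +
        (∑ j : Fin k, (-1 : ULift.{u} ℤ) ^ ((j : ℕ) + 1) • ∑ u : G, cochainEquiv (k + 1) f
          (Fin.insertNth j.succ (u⁻¹ * h j) (Function.update h j u)) +
        (-1 : ULift.{u} ℤ) ^ (k + 1) • ∑ u : G, cochainEquiv (k + 1) f (Fin.snoc h u)) := by
    change Additive.ofMul (dDown G A k f h) = _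
    simp only [dDown, finprod_eq_prod_of_fintype, ofMul_mul, ofMul_prod, mul_assoc, ofMul_zpow]
    rfl
  rw [hD]
  have h1 : ∑ g : Fin (k + 1) → G, Finsupp.single (fun i : Fin k => g i.succ)
      ((rep G A).ρ (g 0)⁻¹ (cochainEquiv (k + 1) f g)) h =
      ∑ u : G, (rep G A).ρ u⁻¹ (cochainEquiv (k + 1) f (Fin.cons u h)) :=
    Finset.sum_single_apply_of_section
      (φ := fun (g : Fin (k + 1) → G) (i : Fin k) => g i.succ) (y := h)
      (fun u : G => (Fin.cons u h : Fin (k + 1) → G)) (fun g => g 0)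
      (fun u => rfl) (fun u => rfl) (fun g hg => by rw [← hg]; exact Fin.cons_self_tail g)
      (fun g => (rep G A).ρ (g 0)⁻¹ (cochainEquiv (k + 1) f g))
  have h2 (j : Fin k) : ∑ g : Fin (k + 1) → G, Finsupp.single
      (Fin.contractNth j.castSucc (· * ·) g) (cochainEquiv (k + 1) f g) h =
      ∑ u : G, cochainEquiv (k + 1) f
        (Fin.insertNth j.succ (u⁻¹ * h j) (Function.update h j u)) :=
    Finset.sum_single_apply_of_section
      (φ := fun g : Fin (k + 1) → G => Fin.contractNth j.castSucc (· * ·) g) (y := h)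
      (fun u : G =>
        (Fin.insertNth j.succ (u⁻¹ * h j) (Function.update h j u) : Fin (k + 1) → G))
      (fun g => g j.castSucc) (fun u => Fin.contractNth_castSucc_insertNth j h u)
      (fun u => by
        rw [← Fin.succAbove_of_castSucc_lt j.succ j Fin.castSucc_lt_succ,
          Fin.insertNth_apply_succAbove, Function.update_self])
      (fun g hg => by rw [← hg]; exact Fin.insertNth_contractNth_castSucc j g)
      (cochainEquiv (k + 1) f)
  have h3 : ∑ g : Fin (k + 1) → G, Finsupp.single
      (Fin.contractNth (Fin.last k) (· * ·) g) (cochainEquiv (k + 1) f g) h =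
      ∑ u : G, cochainEquiv (k + 1) f (Fin.snoc h u) :=
    Finset.sum_single_apply_of_section
      (φ := fun g : Fin (k + 1) → G => Fin.contractNth (Fin.last k) (· * ·) g) (y := h)
      (fun u : G => (Fin.snoc h u : Fin (k + 1) → G)) (fun g => g (Fin.last k))
      (fun u => by rw [Fin.contractNth_last, Fin.init_snoc])
      (fun u => by rw [Fin.snoc_last])
      (fun g hg => by rw [← hg, Fin.contractNth_last]; exact Fin.snoc_init_self g)
      (cochainEquiv (k + 1) f)
  have hd (g : Fin (k + 1) → G) :=
    DFunLike.congr_fun (groupHomology.inhomogeneousChains.d_single (A := rep G A) k g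
      (cochainEquiv (k + 1) f g)) h
  rw [Finset.sum_congr rfl fun g _ => hd g]
  simp only [Finsupp.add_apply, Finsupp.finsetSum_apply, Finsupp.smul_apply]
  rw [Finset.sum_add_distrib, Finset.sum_comm, Fin.sum_univ_castSucc]
  exact congrArg₂ _ h1 (congrArg₂ _
    (Finset.sum_congr rfl fun j _ => Finset.smul_sum.symm.trans (congrArg _ (h2 j)))
    (Finset.smul_sum.symm.trans (congrArg _ h3)))

theorem isZeroH_iff [Fintype G] (n : ℤ) :
    IsZeroH G A n ↔ IsZero (tateCohomology (rep G A) n) := by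
  match n with
  | Int.ofNat 0 =>
    refine Iff.trans ?_ (TateCohomology.isZero_zero_iff_tateNorm _).symm
    exact exact_iff_of_equiv (chainEquiv 0) (cochainEquiv 0) (cochainEquiv 1)
      tateNorm_chainEquiv (d_cochainEquiv 0) rfl
  | Int.ofNat (k + 1) =>
    refine Iff.trans ?_ (TateCohomology.isZero_ofNat_succ_iff _ k).symm
    exact exact_iff_of_equiv (cochainEquiv k) (cochainEquiv (k + 1)) (cochainEquiv (k + 2))
      (d_cochainEquiv k) (d_cochainEquiv (k + 1)) rfl
  | Int.negSucc 0 =>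
    refine Iff.trans ?_ (TateCohomology.isZero_neg_one_iff_tateNorm _).symm
    exact exact_iff_of_equiv (chainEquiv 1) (chainEquiv 0) (cochainEquiv 0)
      (d_chainEquiv 0) tateNorm_chainEquiv rfl
  | Int.negSucc (k + 1) =>
    refine Iff.trans ?_ (TateCohomology.isZero_negSucc_succ_iff _ k).symm
    exact exact_iff_of_equiv (chainEquiv (k + 2)) (chainEquiv (k + 1)) (chainEquiv k)
      (d_chainEquiv (k + 1)) (d_chainEquiv k) (Finsupp.ext fun _ => rfl)

end TateComplex

namespace TateComplex

section Transport

variable {G G' A A' : Type*} [Group G] [Group G'] [CommGroup A] [CommGroup A']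
  (e : G ≃* G') (a : A ≃* A')

/-- Transport of cochains along isomorphisms of the group and of the coefficients. -/
def transport (k : ℕ) : ((Fin k → G) → A) ≃ ((Fin k → G') → A') :=
  (((Equiv.refl (Fin k)).arrowCongr e.toEquiv).arrowCongr a.toEquiv)

theorem transport_apply (k : ℕ) (f : (Fin k → G) → A) (g : Fin k → G') :
    transport e a k f g = a (f (e.symm ∘ g)) :=
  rfl

theorem transport_one (k : ℕ) : transport e a k 1 = 1 :=
  funext fun _ => map_one a

theorem map_finprod_eq [Finite G] {F : G → A} {F' : G' → A'}
    (h : ∀ g, a (F g) = F' (e g)) : a (∏ᶠ g, F g) = ∏ᶠ g, F' g := by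
  rw [MulEquiv.map_finprod, finprod_eq_of_bijective e e.bijective h]

variable {e a} [MulDistribMulAction G A] [MulDistribMulAction G' A']

theorem dUp_transport (he : ∀ g x, a (g • x) = e g • a x) (k : ℕ) (f : (Fin k → G) → A) :
    dUp G' A' k (transport e a k f) = transport e a (k + 1) (dUp G A k f) := by
  funext g
  simp only [dUp, transport_apply, map_mul, map_prod, map_zpow, he, Function.comp_apply,
    MulEquiv.apply_symm_apply]
  congr 1
  refine Finset.prod_congr rfl fun j _ => ?_
  rw [Fin.comp_contractNth (· * ·) (· * ·) fun x y => map_mul e.symm x y]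

theorem dNorm_transport [Finite G] (he : ∀ g x, a (g • x) = e g • a x) (f : (Fin 0 → G) → A) :
    dNorm G' A' (transport e a 0 f) = transport e a 0 (dNorm G A f) := by
  funext x
  exact (map_finprod_eq e a fun g => he g _).symm

theorem dDown_transport [Finite G] (he : ∀ g x, a (g • x) = e g • a x) (k : ℕ)
    (f : (Fin (k + 1) → G) → A) :
    dDown G' A' k (transport e a (k + 1) f) = transport e a k (dDown G A k f) := by
  funext h
  simp only [dDown, transport_apply, map_mul, map_prod, map_zpow]
  congr 1
  · congr 1
    · refine (map_finprod_eq e a fun g => ?_).symm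
      rw [he, map_inv]
      congr 3
      funext i
      refine Fin.cases ?_ (fun i => ?_) i <;> simp
    · refine Finset.prod_congr rfl fun j _ => ?_
      congr 1
      refine (map_finprod_eq e a fun g => ?_).symm
      congr 2
      funext i
      refine Fin.succAboveCases j.succ ?_ (fun i => ?_) i
      · simp only [Function.comp_apply, Fin.insertNth_apply_same, map_mul, map_inv,
          MulEquiv.symm_apply_apply]
      · simp only [Function.comp_apply, Fin.insertNth_apply_succAbove]
        obtain rfl | hi := eq_or_ne i j
        · simp only [Function.update_self, MulEquiv.symm_apply_apply]
        · simp only [Function.update_of_ne hi, Function.comp_apply]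
  · congr 1
    refine (map_finprod_eq e a fun g => ?_).symm
    congr 2
    funext i
    refine Fin.lastCases ?_ (fun i => ?_) i <;> simp

theorem isZeroH_iff_of_mulEquiv [Finite G] (e : G ≃* G') (a : A ≃* A')
    (he : ∀ g x, a (g • x) = e g • a x) (n : ℤ) : IsZeroH G A n ↔ IsZeroH G' A' n := by
  match n with
  | Int.ofNat 0 =>
    exact exact_iff_of_equiv (transport e a 0) (transport e a 0) (transport e a 1)
      (dNorm_transport he) (dUp_transport he 0) (transport_one e a 1)
  | Int.ofNat (k + 1) =>
    exact exact_iff_of_equiv (transport e a k) (transport e a (k + 1)) (transport e a (k + 2))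
      (dUp_transport he k) (dUp_transport he (k + 1)) (transport_one e a (k + 2))
  | Int.negSucc 0 =>
    exact exact_iff_of_equiv (transport e a 1) (transport e a 0) (transport e a 0)
      (dDown_transport he 0) (dNorm_transport he) (transport_one e a 0)
  | Int.negSucc (k + 1) =>
    exact exact_iff_of_equiv (transport e a (k + 2)) (transport e a (k + 1)) (transport e a k)
      (dDown_transport he (k + 1)) (dDown_transport he k) (transport_one e a k)

end Transport

theorem isZeroH_subgroup_of_isZeroH {p : ℕ} [Fact p.Prime] {G A : Type u} [Group G] [Finite G]
    (hG : IsPGroup p G) [CommGroup A] [Finite A] (hA : IsPGroup p A) [MulDistribMulAction G A]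
    {n : ℤ} (hn : IsZeroH G A n) (S : Subgroup G) (k : ℤ) : IsZeroH S A k := by
  have := Fintype.ofFinite G
  have := Fintype.ofFinite S
  obtain ⟨m, hm⟩ := IsPGroup.iff_card.1 hA
  have : Finite (rep G A) := inferInstanceAs (Finite A)
  refine (isZeroH_iff k).2 (TateCohomology.isZero_res_of_isZero hG (rep G A) (m := m)
    (fun v => ?_) ((isZeroH_iff n).1 hn) S k)
  have h : (Additive.toMul (α := A) v) ^ p ^ m = 1 := hm ▸ pow_card_eq_one'
  exact congrArg Additive.ofMul h

end TateComplex

/-- **Proposition 2.1** (Gaschütz–Uchida).  If `Q` is a finite `p`-group and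
`A` a `Q`-module whose underlying abelian group is a finite `p`-group, and some
Tate cohomology group `Ĥ^n(Q, A)` vanishes, then `A` is cohomologically
trivial: `Ĥ^k(S, A) = 0` for every subgroup `S ≤ Q` and every `k ∈ ℤ`. -/
theorem cohomologicallyTrivial_of_tate_isZero (p : ℕ) (hp : p.Prime)
    (Q : Type*) [Group Q] [Finite Q] (hQ : IsPGroup p Q)
    (A : Type*) [CommGroup A] [Finite A] (hA : IsPGroup p A)
    [MulDistribMulAction Q A]
    (n : ℤ) (hn : TateComplex.IsZeroH Q A n) :
    ∀ (S : Subgroup Q) (k : ℤ), TateComplex.IsZeroH ↥S A k := by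
  intro S k
  have : Fact p.Prime := ⟨hp⟩
  let e : Q ≃* ULift.{u_2} Q := MulEquiv.ulift.symm
  let a : A ≃* ULift.{u_1} A := MulEquiv.ulift.symm
  rw [TateComplex.isZeroH_iff_of_mulEquiv e a fun _ _ => rfl] at hn
  rw [TateComplex.isZeroH_iff_of_mulEquiv (MulEquiv.subgroupMap e S) a fun _ _ => rfl]
  exact TateComplex.isZeroH_subgroup_of_isZeroH (hQ.of_equiv e) (hA.of_equiv a) hn _ k
end

section
/- Let p be a prime, Q a finite p-group, and A ≠ 1 a Q-module whose underlying abelian group is a finite p-group. If A is cohomologically trivial, then for every subgroup K ≤ Q one has C_Q(A_K) = K, where A_K denotes the subgroup of elements of A fixed by every element of K and C_Q(A_K) = {q ∈ Q | q fixes every element of A_K}. -/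
/-- If every element fixed by `H` is fixed by `G`, then the `G`-norm of `a` is the
`H.index`-th power of its `H`-norm. -/
theorem prod_smul_eq_prod_smul_pow_index {G A : Type*} [Group G] [Fintype G] [CommGroup A]
    [MulDistribMulAction G A] (H : Subgroup G) [Fintype H]
    (hH : ∀ a : A, (∀ h : H, (h : G) • a = a) → ∀ g : G, g • a = a) (a : A) :
    ∏ g : G, g • a = (∏ h : H, (h : G) • a) ^ H.index := by
  classical
  have hfix : ∀ g : G, g • ∏ h : H, (h : G) • a = ∏ h : H, (h : G) • a := by
    refine hH _ fun k => ?_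
    rw [Finset.smul_prod']
    refine Fintype.prod_equiv (Equiv.mulLeft k) _ _ fun h => ?_
    simp [mul_smul]
  have : Fintype (G ⧸ H) := Fintype.ofFinite _
  have hbij : Function.Bijective fun x : (G ⧸ H) × H => x.1.out * (x.2 : G) := by
    rw [Fintype.bijective_iff_injective_and_card]
    constructor
    · rintro ⟨x, h⟩ ⟨y, k⟩ hxy
      have hq : x = y := by
        simpa [QuotientGroup.mk_mul_of_mem] using congrArg (QuotientGroup.mk (s := H)) hxy
      subst hq
      simpa using hxy
    · simpa [Nat.card_eq_fintype_card] using H.card_eq_card_quotient_mul_card_subgroup.symm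
  rw [← hbij.prod_comp fun g => g • a, Fintype.prod_prod_type]
  simp_rw [mul_smul, ← Finset.smul_prod', hfix]
  rw [Finset.prod_const, Finset.card_univ, Subgroup.index, Nat.card_eq_fintype_card]

/-- Vanishing of `Ĥ⁰(G, A)`: every `G`-fixed element is a norm. -/
theorem TateComplex.exists_prod_smul_eq_of_isZeroH_zero {G A : Type*} [Group G] [Fintype G]
    [CommGroup A] [MulDistribMulAction G A] (h : TateComplex.IsZeroH G A 0) {b : A}
    (hb : ∀ g : G, g • b = b) : ∃ a : A, ∏ g : G, g • a = b := by
  obtain ⟨e, he⟩ := h (fun _ => b) (by funext g; simp [TateComplex.dUp, hb])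
  refine ⟨e default, ?_⟩
  simpa [TateComplex.dNorm, finprod_eq_prod_of_fintype, Subsingleton.elim _ (default : Fin 0 → G)]
    using congrFun he default

/-- If `Ĥ⁰(G, A)` vanishes for a finite `p`-group `G` and a nontrivial finite `p`-group `A`,
then a subgroup with the same fixed points as `G` is all of `G`. -/
theorem TateComplex.eq_top_of_isZeroH_zero {p : ℕ} [Fact p.Prime] {G A : Type*} [Group G]
    [Finite G] (hG : IsPGroup p G) [CommGroup A] [Finite A] [Nontrivial A] (hA : IsPGroup p A)
    [MulDistribMulAction G A] (h0 : TateComplex.IsZeroH G A 0) (H : Subgroup G)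
    (hH : ∀ a : A, (∀ h : H, (h : G) • a = a) → ∀ g : G, g • a = a) : H = ⊤ := by
  have := Fintype.ofFinite G
  have := Fintype.ofFinite H
  let F : Subgroup A := FixedPoints.subgroup G A
  have hsurj : Function.Surjective fun x : F => x ^ H.index := by
    rintro ⟨b, hb⟩
    obtain ⟨a, ha⟩ := exists_prod_smul_eq_of_isZeroH_zero h0 (b := b) hb
    rw [prod_smul_eq_prod_smul_pow_index H hH] at ha
    refine ⟨⟨∏ h : H, (h : G) • a, hH _ fun k => ?_⟩, Subtype.ext ha⟩
    rw [Finset.smul_prod']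
    refine Fintype.prod_equiv (Equiv.mulLeft k) _ _ fun h => ?_
    simp [mul_smul]
  have hinj := Finite.injective_iff_surjective.2 hsurj
  obtain ⟨n, hn⟩ := hG.index H
  rcases n with _ | n
  · exact Subgroup.index_eq_one.1 (by simpa using hn)
  have hcardA : p ∣ Nat.card A := by
    obtain ⟨m, hm, hc⟩ := hA.nontrivial_iff_card.1 inferInstance
    exact hc ▸ dvd_pow_self p hm.ne'
  obtain ⟨b, hb, hb1⟩ := hG.exists_fixed_point_of_prime_dvd_card_of_fixed_point A hcardA
    (a := (1 : A)) (fun g => smul_one g)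
  have hF : IsPGroup p F := hA.to_subgroup F
  have : Nontrivial F := ⟨⟨⟨b, hb⟩, 1, fun h => hb1 (congrArg Subtype.val h).symm⟩⟩
  have hpF : p ∣ Nat.card F := by
    obtain ⟨m, hm, hc⟩ := hF.nontrivial_iff_card.1 inferInstance
    exact hc ▸ dvd_pow_self p hm.ne'
  obtain ⟨x, hx⟩ := exists_prime_orderOf_dvd_card' p hpF
  have hx1 : x = 1 := hinj (by simp [hn, pow_succ', pow_mul, ← hx, pow_orderOf_eq_one])
  exact absurd (hx1 ▸ hx) (by simpa using (Fact.out : p.Prime).one_lt.ne)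

/-- **Proposition 2.2** (Schmid).  Let `Q` be a finite `p`-group and `A ≠ 1` a
`Q`-module whose underlying abelian group is a finite `p`-group.  If `A` is
cohomologically trivial, then for every subgroup `K ≤ Q` the set of elements of
`Q` fixing the `K`-fixed points `A_K` pointwise is exactly `K`:
`C_Q(A_K) = K`. -/
theorem centralizer_fixedPoints_eq_of_cohomologicallyTrivial (p : ℕ) (hp : p.Prime)
    (Q : Type*) [Group Q] [Finite Q] (hQ : IsPGroup p Q)
    (A : Type*) [CommGroup A] [Finite A] [Nontrivial A] (hA : IsPGroup p A)
    [MulDistribMulAction Q A]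
    (hct : ∀ (S : Subgroup Q) (k : ℤ), TateComplex.IsZeroH ↥S A k) :
    ∀ (K : Subgroup Q) (q : Q),
      (∀ a : A, (∀ x : K, (x : Q) • a = a) → q • a = a) ↔ q ∈ K := by
  intro K q
  refine ⟨fun hq => ?_, fun hq a ha => ha ⟨q, hq⟩⟩
  have : Fact p.Prime := ⟨hp⟩
  let L : Subgroup Q := fixingSubgroup Q {a : A | ∀ x : K, (x : Q) • a = a}
  have hKL : K ≤ L := fun x hx a => a.2 ⟨x, hx⟩
  have htop := TateComplex.eq_top_of_isZeroH_zero (hQ.to_subgroup L) hA (hct L 0)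
    (K.subgroupOf L) fun a ha g => g.2 ⟨a, fun x => ha ⟨⟨x, hKL x.2⟩, x.2⟩⟩
  exact Subgroup.subgroupOf_eq_top.1 htop fun a => hq a a.2
end

section
/- Let p be a prime, G a semi-abelian finite p-group, N a nontrivial normal subgroup of G, and set A = Z(N), regarded as a G/N-module via conjugation. Let S be a subgroup of G containing N such that S/N has exponent p (every nontrivial element of S/N has order p). Then every element of A^p (the subgroup generated by p-th powers of elements of A) is fixed by the conjugation action of every element of S; equivalently, A^p ≤ A_{S/N}, so C_{S/N}(A^p) = S/N. -/
/-- In a semi-abelian group, if `a` commutes with `s ^ p` then `s` commutes with `a ^ p`. -/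
theorem IsSemiAbelian.commute_pow_right {p : ℕ} {G : Type*} [Group G] (hsa : IsSemiAbelian p G)
    {a s : G} (h : Commute a (s ^ p)) : Commute s (a ^ p) := by
  have hconj : (a⁻¹ * s * a) ^ p = s ^ p := by
    have := conj_pow (i := p) (a := a⁻¹) (b := s)
    rw [inv_inv] at this
    rw [this, mul_assoc, ← h.eq, inv_mul_cancel_left]
  have hcomm := (hsa (a⁻¹ * s * a) s 1 one_pos).2 (by simpa using hconj)
  have hpow := (hsa a⁻¹ (s * a⁻¹ * s⁻¹) 1 one_pos).1 (by simpa [mul_assoc] using hcomm)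
  rw [pow_one, conj_pow, inv_pow, eq_mul_inv_iff_mul_eq] at hpow
  exact (Commute.inv_right_iff (a := s)).1 hpow.symm

/-- **Lemma 2.3.**  Let `G` be a semi-abelian finite `p`-group, `N ≠ 1` a
normal subgroup of `G`, `A = Z(N)`, and `N ≤ S ≤ G` with `S/N` of exponent `p`.
Then every element of `A^p` (the subgroup generated by the `p`-th powers of
elements of `A`) is fixed under conjugation by every element of `S`; that is,
`A^p ≤ A_{S/N}`, and hence `C_{S/N}(A^p) = S/N`. -/
theorem conj_fixed_on_center_pow_p (p : ℕ) (hp : p.Prime) (G : Type*) [Group G] [Finite G]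
    (hG : IsPGroup p G) (hsa : IsSemiAbelian p G)
    (N : Subgroup G) [N.Normal] (hN : N ≠ ⊥)
    (S : Subgroup G) (hNS : N ≤ S) (hexp : ∀ s ∈ S, s ^ p ∈ N) :
    ∀ s ∈ S, ∀ x ∈ Subgroup.closure
        {b : G | ∃ a ∈ Subgroup.map N.subtype (Subgroup.center ↥N), a ^ p = b},
      s⁻¹ * x * s = x := by
  intro s hs x hx
  have hle : Subgroup.closure
      {b : G | ∃ a ∈ Subgroup.map N.subtype (Subgroup.center ↥N), a ^ p = b} ≤
      Subgroup.centralizer {s} := by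
    rw [Subgroup.closure_le]
    rintro _ ⟨_, ⟨a, ha, rfl⟩, rfl⟩
    refine Subgroup.mem_centralizer_singleton_iff.2 (hsa.commute_pow_right ?_).symm.eq
    exact (congrArg N.subtype (Subgroup.mem_center_iff.1 ha ⟨s ^ p, hexp s hs⟩)).symm
  rw [mul_assoc, Subgroup.mem_centralizer_singleton_iff.1 (hle hx), inv_mul_cancel_left]
end

section
/- Let p be a prime, G a semi-abelian finite p-group, and δ : G → Z(Φ(G)) a derivation (for the conjugation action of G on Z(Φ(G))) that is trivial on Φ(G), i.e. δ(y) = 1 for all y ∈ Φ(G). Then δ(x)^p = 1 for every x ∈ G; that is, the group of such derivations has exponent dividing p. -/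
/-- In a finite `p`-group every `p`-th power lies in the Frattini subgroup. -/
theorem IsPGroup.pow_mem_frattini {p : ℕ} (hp : p.Prime) {G : Type*} [Group G] [Finite G]
    (hG : IsPGroup p G) (x : G) : x ^ p ∈ frattini G := by
  have : Fact p.Prime := ⟨hp⟩
  have : Group.IsNilpotent G := hG.isNilpotent
  simp only [frattini, Order.radical, Subgroup.mem_iInf]
  intro K hK
  have : K.Normal := Subgroup.NormalizerCondition.normal_of_coatom K
    Group.normalizerCondition_of_isNilpotent hK
  by_contra hx
  have htop : K ⊔ Subgroup.zpowers (x ^ p) = ⊤ := hK.2 _ <| lt_of_le_of_ne le_sup_left fun h =>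
    hx (h ▸ (le_sup_right : Subgroup.zpowers (x ^ p) ≤ _) (Subgroup.mem_zpowers _))
  obtain ⟨k, hk, z, hz, hkz⟩ := Subgroup.mem_sup_of_normal_left.mp
    (htop ▸ Subgroup.mem_top x : x ∈ K ⊔ Subgroup.zpowers (x ^ p))
  obtain ⟨m, rfl⟩ := Subgroup.mem_zpowers_iff.mp hz
  have hq : (x : G ⧸ K) = (x : G ⧸ K) ^ ((p : ℤ) * m) := by
    conv_lhs => rw [← hkz]
    rw [QuotientGroup.mk_mul, (QuotientGroup.eq_one_iff k).mpr hk, one_mul,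
      QuotientGroup.mk_zpow, QuotientGroup.mk_pow, zpow_mul, zpow_natCast]
  have hiter (j : ℕ) : (x : G ⧸ K) = (x : G ⧸ K) ^ (((p : ℤ) * m) ^ j) := by
    induction j with
    | zero => simp
    | succ j ih => rw [pow_succ, zpow_mul, ← ih, ← hq]
  obtain ⟨j, hj⟩ := hG x
  have hone : (x : G ⧸ K) = 1 := by
    rw [hiter j, mul_pow, zpow_mul, ← Nat.cast_pow, zpow_natCast, ← QuotientGroup.mk_pow, hj,
      QuotientGroup.mk_one, one_zpow]
  exact hx (K.pow_mem ((QuotientGroup.eq_one_iff x).mp hone) p)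

/-- The value of a derivation (for right conjugation) on a power. -/
theorem mul_derivation_pow {G : Type*} [Group G] {δ : G → G}
    (hder : ∀ x y : G, δ (x * y) = y⁻¹ * δ x * y * δ y) (x : G) (n : ℕ) :
    x ^ n * δ (x ^ n) = (x * δ x) ^ n := by
  induction n with
  | zero => simpa using hder 1 1
  | succ n ih =>
    rw [pow_succ (x * δ x), ← ih, pow_succ, hder]
    group

/-- Let `G` be a semi-abelian finite `p`-group and let `δ : G → Z(Φ(G))` be a
derivation (for the conjugation action of `G` on `Z(Φ(G))`) that is trivial on
`Φ(G)`.  Then `δ(x) ^ p = 1` for every `x ∈ G`; that is, the group of such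
derivations has exponent dividing `p`. -/
theorem derivation_pow_p_eq_one_of_isSemiAbelian (p : ℕ) (hp : p.Prime)
    (G : Type*) [Group G] [Finite G] (hG : IsPGroup p G) (hsa : IsSemiAbelian p G)
    (δ : G → G)
    (hmem : ∀ x : G, δ x ∈ Subgroup.map (frattini G).subtype (Subgroup.center ↥(frattini G)))
    (htriv : ∀ y ∈ frattini G, δ y = 1)
    (hder : ∀ x y : G, δ (x * y) = y⁻¹ * δ x * y * δ y) :
    ∀ x : G, δ x ^ p = 1 := by
  intro x
  have hpow : (x * δ x) ^ p = x ^ p := by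
    rw [← mul_derivation_pow hder, htriv _ (hG.pow_mem_frattini hp x), mul_one]
  have hconj := (hsa (x * δ x) x 1 one_pos).mpr (by simpa using hpow)
  rwa [pow_one, conj_pow, conj_eq_one_iff] at hconj
end

section
/- Let p be an odd prime, d and n positive integers, F the free group on d generators, and G_n = F / λ_{n+1}^p(F), where λ_k^p denotes the lower p-series. Then G_n is a finite p-group that is p-central, i.e. every element of G_n of order p is central; more precisely, Ω_1(G_n) = λ_n^p(F)/λ_{n+1}^p(F). -/
/-- The lower `p`-series of a group `S`, indexed so that `lambdaP p S k` is the
term `λ_{k+1}^p(S)` of the paper: `λ_1^p(S) = S` and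
`λ_{k+1}^p(S) = [λ_k^p(S), S] * (λ_k^p(S))^p`. -/
def lambdaP (p : ℕ) (S : Type*) [Group S] : ℕ → Subgroup S
  | 0 => ⊤
  | k + 1 =>
    ⁅lambdaP p S k, (⊤ : Subgroup S)⁆ ⊔
      Subgroup.closure {x : S | ∃ y ∈ lambdaP p S k, y ^ p = x}

section GroupIdentities

open scoped commutatorElement

variable {Q : Type*} [Group Q]

/-- If `⁅h, g⁆` commutes with `g` and `h` and has exponent dividing the odd number `p`, then
`(g * h) ^ p = g ^ p * h ^ p`. -/
theorem mul_pow_of_commutator_commute {p : ℕ} (hodd : Odd p) {g h : Q}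
    (hg : Commute ⁅h, g⁆ g) (hh : Commute ⁅h, g⁆ h) (hz : ⁅h, g⁆ ^ p = 1) :
    (g * h) ^ p = g ^ p * h ^ p := by
  have hhg : h * g = ⁅h, g⁆ * (g * h) := by simp [commutatorElement_def, mul_assoc]
  generalize ⁅h, g⁆ = z at *
  have h1 : ∀ n : ℕ, h ^ n * g = z ^ n * g * h ^ n := by
    intro n
    induction n with
    | zero => simp
    | succ n ih =>
      calc h ^ (n + 1) * g = h * (h ^ n * g) := by rw [pow_succ', mul_assoc]
        _ = (h * z ^ n) * g * h ^ n := by rw [ih]; simp only [mul_assoc]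
        _ = z ^ n * (h * g) * h ^ n := by rw [← (hh.pow_left n).eq]; simp only [mul_assoc]
        _ = z ^ (n + 1) * g * h ^ (n + 1) := by
          rw [hhg, pow_succ z, pow_succ' h]; simp only [mul_assoc]
  have h2 : ∀ n : ℕ, (g * h) ^ n = z ^ (∑ i ∈ Finset.range n, i) * (g ^ n * h ^ n) := by
    intro n
    induction n with
    | zero => simp
    | succ n ih =>
      calc (g * h) ^ (n + 1)
          = z ^ (∑ i ∈ Finset.range n, i) * (g ^ n * (h ^ n * g) * h) := by
            rw [pow_succ, ih]; simp only [mul_assoc]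
        _ = z ^ (∑ i ∈ Finset.range n, i) * ((g ^ n * z ^ n) * g * h ^ n * h) := by
            rw [h1]; simp only [mul_assoc]
        _ = _ := by
            rw [← (hg.pow_pow n n).eq, Finset.sum_range_succ, pow_add, pow_succ g, pow_succ h]
            simp only [mul_assoc]
  rw [h2 p, Finset.sum_range_id]
  obtain ⟨m, rfl⟩ := hodd
  rw [show (2 * m + 1) * (2 * m + 1 - 1) / 2 = (2 * m + 1) * m by
    rw [Nat.add_sub_cancel]; apply Nat.div_eq_of_eq_mul_left two_pos; ring]
  rw [pow_mul, hz, one_pow, one_mul]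

/-- If `⁅g, ⁅g, h⁆⁆` commutes with `g` and `⁅g, h⁆` and has exponent dividing the odd number `p`,
then `⁅g ^ p, h⁆ = ⁅g, h⁆ ^ p`. -/
theorem commutator_pow_left_of_commute {p : ℕ} (hodd : Odd p) {g h : Q}
    (hg : Commute ⁅g, ⁅g, h⁆⁆ g) (hc : Commute ⁅g, ⁅g, h⁆⁆ ⁅g, h⁆)
    (hz : ⁅g, ⁅g, h⁆⁆ ^ p = 1) :
    ⁅g ^ p, h⁆ = ⁅g, h⁆ ^ p := by
  have e1 : g * h * g⁻¹ = ⁅g, h⁆ * h := by simp [commutatorElement_def]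
  have e2 : g * ⁅g, h⁆ * g⁻¹ = ⁅g, ⁅g, h⁆⁆ * ⁅g, h⁆ := by
    rw [commutatorElement_def g ⁅g, h⁆, inv_mul_cancel_right]
  generalize ⁅g, ⁅g, h⁆⁆ = e at *
  generalize hcdef : ⁅g, h⁆ = c at *
  have key : ∀ n : ℕ, g ^ n * h * (g ^ n)⁻¹ = e ^ (∑ i ∈ Finset.range n, i) * c ^ n * h := by
    intro n
    induction n with
    | zero => simp
    | succ n ih =>
      have e3 : g * e ^ (∑ i ∈ Finset.range n, i) * g⁻¹ = e ^ (∑ i ∈ Finset.range n, i) := by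
        rw [← (hg.pow_left _).eq]; simp
      have e4 : g * c ^ n * g⁻¹ = e ^ n * c ^ n := by
        rw [← conj_pow, e2, hc.mul_pow]
      calc g ^ (n + 1) * h * (g ^ (n + 1))⁻¹ = g * (g ^ n * h * (g ^ n)⁻¹) * g⁻¹ := by
            rw [pow_succ']; simp [mul_assoc]
        _ = (g * e ^ (∑ i ∈ Finset.range n, i) * g⁻¹) * (g * c ^ n * g⁻¹) * (g * h * g⁻¹) := by
            rw [ih]; simp [mul_assoc]
        _ = _ := by
            rw [e3, e4, e1, Finset.sum_range_succ, pow_add, pow_succ c]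
            simp only [mul_assoc]
  rw [commutatorElement_def, key, Finset.sum_range_id]
  obtain ⟨m, rfl⟩ := hodd
  rw [show (2 * m + 1) * (2 * m + 1 - 1) / 2 = (2 * m + 1) * m by
    rw [Nat.add_sub_cancel]; apply Nat.div_eq_of_eq_mul_left two_pos; ring]
  simp [pow_mul, hz]

theorem commutator_mul_left_of_central {a b c : Q} (h : ∀ q, Commute ⁅b, c⁆ q) :
    ⁅a * b, c⁆ = ⁅a, c⁆ * ⁅b, c⁆ := by
  have : ⁅a * b, c⁆ = a * ⁅b, c⁆ * a⁻¹ * ⁅a, c⁆ := by simp [commutatorElement_def, mul_assoc]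
  rw [this, ← (h a).eq, mul_inv_cancel_right, (h _).eq]

theorem commutator_mul_right_of_central {a b c : Q} (h : ∀ q, Commute ⁅a, c⁆ q) :
    ⁅a, b * c⁆ = ⁅a, b⁆ * ⁅a, c⁆ := by
  have : ⁅a, b * c⁆ = ⁅a, b⁆ * (b * ⁅a, c⁆ * b⁻¹) := by simp [commutatorElement_def, mul_assoc]
  rw [this, ← (h b).eq, mul_inv_cancel_right]

/-- A form of the Jacobi identity for commutators whose higher error terms vanish. -/
theorem commutator_commutator_eq_mul {x a b : Q}
    (h1 : ∀ q, Commute ⁅⁅x, a⁆, b⁆ q) (h2 : ∀ q, Commute ⁅a, ⁅x, b⁆⁆ q)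
    (h3 : Commute ⁅x, a⁆ ⁅a, b⁆) (h4 : Commute ⁅x, b⁆ ⁅a, b⁆)
    (h5 : Commute ⁅x, a⁆ ⁅x, b⁆) :
    ⁅x, ⁅a, b⁆⁆ = ⁅⁅x, a⁆, b⁆ * ⁅a, ⁅x, b⁆⁆ := by
  have e : x * ⁅a, b⁆ * x⁻¹ = ⁅⁅x, a⁆ * a, ⁅x, b⁆ * b⁆ := by
    simp [commutatorElement_def, mul_assoc]
  rw [commutatorElement_def x ⁅a, b⁆, e]
  generalize ⁅x, a⁆ = u at *
  generalize ⁅x, b⁆ = v at *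
  have e1 : ⁅u * a, v * b⁆ = u * ⁅a, v * b⁆ * u⁻¹ * ⁅u, v * b⁆ := by
    simp [commutatorElement_def, mul_assoc]
  have e2 : ⁅u, v * b⁆ = ⁅u, b⁆ := by
    rw [commutator_mul_right_of_central h1, commutatorElement_eq_one_iff_commute.2 h5, one_mul]
  have e3 : ⁅a, v * b⁆ = ⁅a, v⁆ * ⁅a, b⁆ := by
    have : ⁅a, v * b⁆ = ⁅a, v⁆ * (v * ⁅a, b⁆ * v⁻¹) := by simp [commutatorElement_def, mul_assoc]
    rw [this, h4.eq, mul_inv_cancel_right]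
  have h6 : Commute u (⁅a, v⁆ * ⁅a, b⁆) := ((h2 u).symm).mul_right h3
  rw [e1, e2, e3, h6.eq, mul_inv_cancel_right, mul_assoc, mul_assoc, ← mul_assoc ⁅a, b⁆,
    ← (h1 ⁅a, b⁆).eq, mul_inv_cancel_right, (h2 _).eq]

/-- The three subgroups lemma modulo a normal subgroup. -/
theorem Subgroup.commutator_commutator_le_of_rotate {H₁ H₂ H₃ N : Subgroup Q} [N.Normal]
    (h1 : ⁅⁅H₂, H₃⁆, H₁⁆ ≤ N) (h2 : ⁅⁅H₃, H₁⁆, H₂⁆ ≤ N) : ⁅⁅H₁, H₂⁆, H₃⁆ ≤ N := by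
  have key : ∀ A B C : Subgroup Q, ⁅⁅A, B⁆, C⁆ ≤ N ↔
      ⁅⁅A.map (QuotientGroup.mk' N), B.map (QuotientGroup.mk' N)⁆,
        C.map (QuotientGroup.mk' N)⁆ = ⊥ := by
    intro A B C
    rw [← Subgroup.map_commutator, ← Subgroup.map_commutator, Subgroup.map_eq_bot_iff,
      QuotientGroup.ker_mk']
  rw [key] at *
  exact Subgroup.commutator_commutator_eq_bot_of_rotate h1 h2

end GroupIdentities

section LowerPSeries

open scoped commutatorElement

variable {p : ℕ} {G : Type*} [Group G]

theorem lambdaP_commutator_top_le (k : ℕ) :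
    ⁅lambdaP p G k, (⊤ : Subgroup G)⁆ ≤ lambdaP p G (k + 1) := le_sup_left

theorem pow_mem_lambdaP {k : ℕ} {g : G} (hg : g ∈ lambdaP p G k) :
    g ^ p ∈ lambdaP p G (k + 1) :=
  (le_sup_right : _ ≤ lambdaP p G (k + 1)) (Subgroup.subset_closure ⟨g, hg, rfl⟩)

instance lambdaP_normal (k : ℕ) : (lambdaP p G k).Normal := by
  induction k with
  | zero => exact (inferInstance : (⊤ : Subgroup G).Normal)
  | succ k ih =>
    have : (Subgroup.closure {x : G | ∃ y ∈ lambdaP p G k, y ^ p = x}).Normal := by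
      refine ⟨fun n hn g => ?_⟩
      induction hn using Subgroup.closure_induction with
      | mem x hx =>
        obtain ⟨y, hy, rfl⟩ := hx
        exact Subgroup.subset_closure ⟨g * y * g⁻¹, ih.conj_mem y hy g, conj_pow⟩
      | one => simp
      | mul a b _ _ iha ihb => simpa [mul_assoc] using mul_mem iha ihb
      | inv a _ iha => simpa [mul_assoc] using inv_mem iha
    exact Subgroup.sup_normal _ _

theorem pow_pow_mem_lambdaP {k : ℕ} {g : G} (hg : g ∈ lambdaP p G k) (j : ℕ) :
    g ^ p ^ j ∈ lambdaP p G (k + j) := by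
  induction j with
  | zero => simpa using hg
  | succ j ih =>
    rw [pow_succ, pow_mul]
    exact pow_mem_lambdaP ih

theorem lambdaP_antitone : Antitone (lambdaP p G) := by
  refine antitone_nat_of_succ_le fun k => sup_le (Subgroup.commutator_le_left _ _) ?_
  rw [Subgroup.closure_le]
  rintro _ ⟨y, hy, rfl⟩
  exact pow_mem hy p

theorem lambdaP_quotient_commute {k : ℕ} {g : G} (hg : g ∈ lambdaP p G k)
    (q : G ⧸ lambdaP p G (k + 1)) : Commute (g : G ⧸ lambdaP p G (k + 1)) q := by
  induction q using QuotientGroup.induction_on with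
  | H h =>
    rw [← commutatorElement_eq_one_iff_commute]
    exact (QuotientGroup.eq_one_iff ⁅g, h⁆).2
      (lambdaP_commutator_top_le k (Subgroup.commutator_mem_commutator hg (Subgroup.mem_top h)))

theorem lambdaP_commutator_le (i j : ℕ) :
    ⁅lambdaP p G i, lambdaP p G j⁆ ≤ lambdaP p G (i + j + 1) := by
  induction j generalizing i with
  | zero => exact lambdaP_commutator_top_le i
  | succ j ih =>
    have h1 : ⁅⁅lambdaP p G j, (⊤ : Subgroup G)⁆, lambdaP p G i⁆ ≤ lambdaP p G (i + j + 2) := by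
      refine Subgroup.commutator_commutator_le_of_rotate ?_ ?_
      · rw [Subgroup.commutator_comm ⊤]
        refine (Subgroup.commutator_mono (lambdaP_commutator_top_le i) le_rfl).trans
          ((ih (i + 1)).trans_eq ?_)
        congr 1; ring
      · exact (Subgroup.commutator_mono (ih i) le_rfl).trans (lambdaP_commutator_top_le _)
    rw [Subgroup.commutator_comm, Subgroup.commutator_le]
    intro a ha b hb
    -- Membership in the centralizer of `b` modulo the target.
    let C : Subgroup G := (Subgroup.centralizer {(b : G ⧸ lambdaP p G (i + j + 2))}).comap
      (QuotientGroup.mk' _)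
    have hC : ∀ y : G, y ∈ C ↔ ⁅y, b⁆ ∈ lambdaP p G (i + j + 2) := by
      intro y
      rw [← QuotientGroup.eq_one_iff (N := lambdaP p G (i + j + 2))]
      simp only [C, Subgroup.mem_comap, Subgroup.mem_centralizer_singleton_iff]
      exact (commutatorElement_eq_one_iff_commute (g₁ := (y : G ⧸ lambdaP p G (i + j + 2)))).symm
    suffices lambdaP p G (j + 1) ≤ C from (hC a).1 (this ha)
    refine sup_le (fun y hy => (hC y).2 (h1 (Subgroup.commutator_mem_commutator hy hb))) ?_
    rw [Subgroup.closure_le]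
    rintro _ ⟨y, hy, rfl⟩
    refine (hC _).2 ?_
    have hyb : ⁅y, b⁆ ∈ lambdaP p G (i + j + 1) := by
      have := ih i
      rw [Subgroup.commutator_comm] at this
      exact this (Subgroup.commutator_mem_commutator hy hb)
    have hcomm := lambdaP_quotient_commute hyb
    rw [← QuotientGroup.eq_one_iff]
    have key : ∀ n : ℕ, ⁅(y : G ⧸ lambdaP p G (i + j + 2)) ^ n, (b : G ⧸ lambdaP p G (i + j + 2))⁆
        = ⁅(y : G ⧸ lambdaP p G (i + j + 2)), (b : G ⧸ lambdaP p G (i + j + 2))⁆ ^ n := by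
      intro n
      induction n with
      | zero => simp
      | succ n ih =>
        rw [pow_succ, commutator_mul_left_of_central hcomm, ih, pow_succ]
    exact (key p).trans ((QuotientGroup.eq_one_iff (⁅y, b⁆ ^ p)).2 (pow_mem_lambdaP hyb))

theorem commutator_mem_lambdaP {i j : ℕ} {g h : G} (hg : g ∈ lambdaP p G i)
    (hh : h ∈ lambdaP p G j) : ⁅g, h⁆ ∈ lambdaP p G (i + j + 1) :=
  lambdaP_commutator_le i j (Subgroup.commutator_mem_commutator hg hh)

theorem lambdaP_quotient_commute_of_le {i j n : ℕ} {g h : G} (hg : g ∈ lambdaP p G i)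
    (hh : h ∈ lambdaP p G j) (hn : n ≤ i + j + 1) :
    Commute (g : G ⧸ lambdaP p G n) (h : G ⧸ lambdaP p G n) := by
  rw [← commutatorElement_eq_one_iff_commute]
  exact (QuotientGroup.eq_one_iff ⁅g, h⁆).2 (lambdaP_antitone hn (commutator_mem_lambdaP hg hh))

theorem lambdaP_mk_commutator_mul_left {i j : ℕ} {a b c : G} (hb : b ∈ lambdaP p G i)
    (hc : c ∈ lambdaP p G j) :
    ((⁅a * b, c⁆ : G) : G ⧸ lambdaP p G (i + j + 2)) = (⁅a, c⁆ * ⁅b, c⁆ : G) :=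
  commutator_mul_left_of_central (Q := G ⧸ lambdaP p G (i + j + 2)) (a := a) (b := b) (c := c)
    (lambdaP_quotient_commute (commutator_mem_lambdaP hb hc))

theorem lambdaP_mk_commutator_mul_right {i j : ℕ} {a b c : G} (ha : a ∈ lambdaP p G i)
    (hc : c ∈ lambdaP p G j) :
    ((⁅a, b * c⁆ : G) : G ⧸ lambdaP p G (i + j + 2)) = (⁅a, b⁆ * ⁅a, c⁆ : G) :=
  commutator_mul_right_of_central (Q := G ⧸ lambdaP p G (i + j + 2)) (a := a) (b := b) (c := c)
    (lambdaP_quotient_commute (commutator_mem_lambdaP ha hc))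

theorem lambdaP_mk_mul_pow (hodd : Odd p) {k : ℕ} {g h : G} (hg : g ∈ lambdaP p G k)
    (hh : h ∈ lambdaP p G k) :
    (((g * h) ^ p : G) : G ⧸ lambdaP p G (k + 2)) = (g ^ p * h ^ p : G) := by
  have hz : ⁅h, g⁆ ∈ lambdaP p G (k + 1) :=
    lambdaP_antitone (by omega) (commutator_mem_lambdaP hh hg)
  exact mul_pow_of_commutator_commute (Q := G ⧸ lambdaP p G (k + 2)) (g := g) (h := h) hodd
    (lambdaP_quotient_commute hz g) (lambdaP_quotient_commute hz h)
    ((QuotientGroup.eq_one_iff (⁅h, g⁆ ^ p)).2 (pow_mem_lambdaP hz))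

theorem lambdaP_mk_commutator_pow_left (hodd : Odd p) {i j : ℕ} {g h : G}
    (hg : g ∈ lambdaP p G i) (hh : h ∈ lambdaP p G j) :
    ((⁅g ^ p, h⁆ : G) : G ⧸ lambdaP p G (i + j + 3)) = (⁅g, h⁆ ^ p : G) := by
  have hz : ⁅g, ⁅g, h⁆⁆ ∈ lambdaP p G (i + j + 2) :=
    lambdaP_antitone (by omega) (commutator_mem_lambdaP hg (commutator_mem_lambdaP hg hh))
  exact commutator_pow_left_of_commute (Q := G ⧸ lambdaP p G (i + j + 3)) (g := g) (h := h) hodd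
    (lambdaP_quotient_commute hz g) (lambdaP_quotient_commute hz (⁅g, h⁆ : G))
    ((QuotientGroup.eq_one_iff (⁅g, ⁅g, h⁆⁆ ^ p)).2 (pow_mem_lambdaP hz))

theorem lambdaP_mk_commutator_pow_right (hodd : Odd p) {i j : ℕ} {g h : G}
    (hg : g ∈ lambdaP p G i) (hh : h ∈ lambdaP p G j) :
    ((⁅g, h ^ p⁆ : G) : G ⧸ lambdaP p G (i + j + 3)) = (⁅g, h⁆ ^ p : G) := by
  have := lambdaP_mk_commutator_pow_left hodd hh hg
  rw [add_comm j i] at this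
  rw [← commutatorElement_inv, ← commutatorElement_inv h g, inv_pow, QuotientGroup.mk_inv, this,
    QuotientGroup.mk_inv]

theorem lambdaP_mk_commutator_commutator {i j k : ℕ} {x a b : G} (hx : x ∈ lambdaP p G i)
    (ha : a ∈ lambdaP p G j) (hb : b ∈ lambdaP p G k) :
    ((⁅x, ⁅a, b⁆⁆ : G) : G ⧸ lambdaP p G (i + j + k + 3)) =
      (⁅⁅x, a⁆, b⁆ * ⁅a, ⁅x, b⁆⁆ : G) := by
  have hxa := commutator_mem_lambdaP hx ha
  have hxb := commutator_mem_lambdaP hx hb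
  have hab := commutator_mem_lambdaP ha hb
  have h1 : ⁅⁅x, a⁆, b⁆ ∈ lambdaP p G (i + j + k + 2) :=
    lambdaP_antitone (by omega) (commutator_mem_lambdaP hxa hb)
  have h2 : ⁅a, ⁅x, b⁆⁆ ∈ lambdaP p G (i + j + k + 2) :=
    lambdaP_antitone (by omega) (commutator_mem_lambdaP ha hxb)
  exact commutator_commutator_eq_mul (Q := G ⧸ lambdaP p G (i + j + k + 3))
    (x := x) (a := a) (b := b)
    (lambdaP_quotient_commute h1) (lambdaP_quotient_commute h2)
    (lambdaP_quotient_commute_of_le hxa hab (by omega))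
    (lambdaP_quotient_commute_of_le hxb hab (by omega))
    (lambdaP_quotient_commute_of_le hxa hxb (by omega))

theorem lambdaP_mk_pow_congr (hodd : Odd p) {k : ℕ} {g h : G} (hg : g ∈ lambdaP p G k)
    (hgh : (g : G ⧸ lambdaP p G (k + 1)) = h) :
    ((g ^ p : G) : G ⧸ lambdaP p G (k + 2)) = (h ^ p : G) := by
  have hl := QuotientGroup.eq.1 hgh
  have := lambdaP_mk_mul_pow hodd hg (lambdaP_antitone (Nat.le_succ k) hl)
  rw [mul_inv_cancel_left, QuotientGroup.mk_mul,
    (QuotientGroup.eq_one_iff ((g⁻¹ * h) ^ p)).2 (pow_mem_lambdaP hl), mul_one] at this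
  exact this.symm

theorem lambdaP_mk_commutator_congr {i j : ℕ} {g g' h h' : G} (hg : g ∈ lambdaP p G i)
    (hh : h ∈ lambdaP p G j) (hgg : (g : G ⧸ lambdaP p G (i + 1)) = g')
    (hhh : (h : G ⧸ lambdaP p G (j + 1)) = h') :
    ((⁅g, h⁆ : G) : G ⧸ lambdaP p G (i + j + 2)) = (⁅g', h'⁆ : G) := by
  have hl := QuotientGroup.eq.1 hgg
  have hm := QuotientGroup.eq.1 hhh
  have hl' := lambdaP_antitone (Nat.le_succ i) hl
  have hm' := lambdaP_antitone (Nat.le_succ j) hm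
  have hh' : h' ∈ lambdaP p G j := by simpa using mul_mem hh hm'
  have h1 := lambdaP_mk_commutator_mul_left (a := g) hl' hh'
  have h2 := lambdaP_mk_commutator_mul_right (b := h) hg hm'
  rw [mul_inv_cancel_left, QuotientGroup.mk_mul, (QuotientGroup.eq_one_iff ⁅g⁻¹ * g', h'⁆).2
    (lambdaP_antitone (by omega) (commutator_mem_lambdaP hl hh')), mul_one] at h1
  rw [mul_inv_cancel_left, QuotientGroup.mk_mul, (QuotientGroup.eq_one_iff ⁅g, h⁻¹ * h'⁆).2
    (lambdaP_antitone (by omega) (commutator_mem_lambdaP hg hm)), mul_one] at h2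
  rw [h1, h2]

end LowerPSeries

section LieSymbol

open scoped commutatorElement

/-- `LieSymbol p x w k g a` says that `g` is, up to the `(k + 1)`-st term of the lower `p`-series,
an expression of degree `k` in the elements `x i` of degrees `w i`, formed with products,
commutators and `p`-th powers, and that `a` is the Lie polynomial over `ZMod p` obtained from this
expression by replacing products by sums, group commutators by ring commutators, and `p`-th powers
by the identity. -/
inductive LieSymbol (p : ℕ) {G : Type*} [Group G] {ι : Type} (x : ι → G) (w : ι → ℕ) :
    ℕ → G → FreeAlgebra (ZMod p) ι → Prop
  | of (i : ι) : LieSymbol p x w (w i) (x i) (FreeAlgebra.ι (ZMod p) i)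
  | zero {k : ℕ} {g : G} (hg : g ∈ lambdaP p G (k + 1)) : LieSymbol p x w k g 0
  | mul {k : ℕ} {g h : G} {a b : FreeAlgebra (ZMod p) ι} (hg : LieSymbol p x w k g a)
      (hh : LieSymbol p x w k h b) : LieSymbol p x w k (g * h) (a + b)
  | pow {k : ℕ} {g : G} {a : FreeAlgebra (ZMod p) ι} (hg : LieSymbol p x w k g a) :
      LieSymbol p x w (k + 1) (g ^ p) a
  | commutator {i j : ℕ} {g h : G} {a b : FreeAlgebra (ZMod p) ι} (hg : LieSymbol p x w i g a)
      (hh : LieSymbol p x w j h b) : LieSymbol p x w (i + j + 1) ⁅g, h⁆ (a * b - b * a)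

namespace LieSymbol

variable {p : ℕ} {G : Type*} [Group G] {ι : Type} {x : ι → G} {w : ι → ℕ}
  {k : ℕ} {g h : G} {a b : FreeAlgebra (ZMod p) ι}

theorem mem (hx : ∀ i, x i ∈ lambdaP p G (w i)) (hg : LieSymbol p x w k g a) :
    g ∈ lambdaP p G k := by
  induction hg with
  | of i => exact hx i
  | zero hg => exact lambdaP_antitone (Nat.le_succ _) hg
  | mul _ _ ih1 ih2 => exact mul_mem ih1 ih2
  | pow _ ih => exact pow_mem_lambdaP ih
  | commutator _ _ ih1 ih2 => exact commutator_mem_lambdaP ih1 ih2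

theorem mem_succ_of_lt (hx : ∀ i, x i ∈ lambdaP p G (w i)) (hw : ∀ i, k < w i)
    (hg : LieSymbol p x w k g a) : g ∈ lambdaP p G (k + 1) := by
  induction hg with
  | of i => exact absurd (hw i) (lt_irrefl _)
  | zero hg => exact hg
  | mul _ _ ih1 ih2 => exact mul_mem (ih1 hw) (ih2 hw)
  | pow _ ih => exact pow_mem_lambdaP (ih fun i => (Nat.lt_succ_self _).trans (hw i))
  | @commutator i j _ _ _ _ hg hh ih1 ih2 =>
    exact lambdaP_antitone (by omega) (commutator_mem_lambdaP
      (ih1 fun l => lt_of_le_of_lt (by omega) (hw l)) (hh.mem hx))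

theorem cast {k' : ℕ} (hk : k = k') (hg : LieSymbol p x w k g a) : LieSymbol p x w k' g a :=
  hk ▸ hg

theorem congr (hg : LieSymbol p x w k g a)
    (hgh : (g : G ⧸ lambdaP p G (k + 1)) = h) : LieSymbol p x w k h a := by
  have := hg.mul (zero (QuotientGroup.eq.1 hgh))
  rwa [mul_inv_cancel_left, add_zero] at this

theorem natPow (hg : LieSymbol p x w k g a) (n : ℕ) : LieSymbol p x w k (g ^ n) (n • a) := by
  induction n with
  | zero => simpa using zero (one_mem _)
  | succ n ih => simpa [pow_succ, add_mul] using ih.mul hg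

theorem inv (hp : 0 < p) (hx : ∀ i, x i ∈ lambdaP p G (w i)) (hg : LieSymbol p x w k g a) :
    LieSymbol p x w k g⁻¹ (-a) := by
  have h1 := hg.natPow (p - 1)
  have h2 : (p - 1) • a = -a := by
    rw [eq_neg_iff_add_eq_zero, ← succ_nsmul, Nat.sub_add_cancel hp, ← Nat.cast_smul_eq_nsmul
      (ZMod p), ZMod.natCast_self, zero_smul]
  rw [h2] at h1
  refine h1.congr (QuotientGroup.eq.2 ?_)
  rw [← mul_inv_rev, ← pow_succ', Nat.sub_add_cancel hp]
  exact inv_mem (pow_mem_lambdaP (hg.mem hx))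

theorem exists_of_mem (hx : ∀ i, w i = 0) (hp : 0 < p) (htop : Subgroup.closure (Set.range x) = ⊤)
    (hg : g ∈ lambdaP p G k) : ∃ a, LieSymbol p x w k g a := by
  have hx' : ∀ i, x i ∈ lambdaP p G (w i) := fun i => by rw [hx i]; exact Subgroup.mem_top _
  have h0 : ∀ g : G, ∃ a, LieSymbol p x w 0 g a := by
    intro g
    have hg : g ∈ Subgroup.closure (Set.range x) := htop ▸ Subgroup.mem_top g
    induction hg using Subgroup.closure_induction with
    | mem _ h =>
      obtain ⟨i, rfl⟩ := h
      exact ⟨_, (of i).cast (hx i)⟩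
    | one => exact ⟨0, zero (one_mem _)⟩
    | mul _ _ _ _ h1 h2 =>
      obtain ⟨_, h1⟩ := h1
      obtain ⟨_, h2⟩ := h2
      exact ⟨_, h1.mul h2⟩
    | inv _ _ h =>
      obtain ⟨_, h⟩ := h
      exact ⟨_, h.inv hp hx'⟩
  induction k generalizing g with
  | zero => exact h0 g
  | succ k ih =>
    have hle : lambdaP p G (k + 1) ≤ Subgroup.closure
        ({z | ∃ g₁ ∈ lambdaP p G k, ∃ g₂ ∈ (⊤ : Subgroup G), ⁅g₁, g₂⁆ = z} ∪
          {z | ∃ y ∈ lambdaP p G k, y ^ p = z}) := by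
      rw [Subgroup.closure_union]
      exact le_rfl
    have hg' := hle hg
    clear hg
    induction hg' using Subgroup.closure_induction with
    | mem _ h =>
      obtain ⟨g₁, h1, g₂, -, rfl⟩ | ⟨y, hy, rfl⟩ := h
      · obtain ⟨_, h1⟩ := ih h1
        obtain ⟨_, h2⟩ := h0 g₂
        exact ⟨_, h1.commutator h2⟩
      · obtain ⟨_, h1⟩ := ih hy
        exact ⟨_, h1.pow⟩
    | one => exact ⟨0, zero (one_mem _)⟩
    | mul _ _ _ _ h1 h2 =>
      obtain ⟨_, h1⟩ := h1
      obtain ⟨_, h2⟩ := h2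
      exact ⟨_, h1.mul h2⟩
    | inv _ _ h =>
      obtain ⟨_, h⟩ := h
      exact ⟨_, h.inv hp hx'⟩

end LieSymbol

end LieSymbol

section Elimination

open scoped commutatorElement

/-- The iterated commutators `⁅x i₀, ⁅x i₀, …, x y⁆⁆` with `y ≠ i₀`. -/
def elimGen {G : Type*} [Group G] {ι : Type} (x : ι → G) (i₀ : ι) :
    ℕ × {y : ι // y ≠ i₀} → G :=
  fun t => (fun h => ⁅x i₀, h⁆)^[t.1] (x t.2)

/-- The degrees of the iterated commutators `elimGen x i₀`. -/
def elimDeg {ι : Type} (w : ι → ℕ) (i₀ : ι) : ℕ × {y : ι // y ≠ i₀} → ℕ :=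
  fun t => w t.2 + t.1 * (w i₀ + 1)

/-- The algebra homomorphism sending the letters `(n, y)` to the iterated ring commutators of `n`
copies of `i₀` with `y`. -/
noncomputable def elimHom (R : Type*) [CommRing R] {ι : Type} (i₀ : ι) :
    FreeAlgebra R (ℕ × {y : ι // y ≠ i₀}) →ₐ[R] FreeAlgebra R ι :=
  FreeAlgebra.lift R fun t =>
    (fun b => FreeAlgebra.ι R i₀ * b - b * FreeAlgebra.ι R i₀)^[t.1] (FreeAlgebra.ι R t.2.1)

/-- A linear map `D` on the free algebra on letters `(n, y)` that annihilates `1` and whose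
commutator with left multiplication by `(n, y)` is left multiplication by `(n + 1, y)`. -/
theorem exists_shift_derivation (R : Type*) [CommRing R] (Y : Type) :
    ∃ D : FreeAlgebra R (ℕ × Y) →ₗ[R] FreeAlgebra R (ℕ × Y), D 1 = 0 ∧
      ∀ n y b, D (FreeAlgebra.ι R (n, y) * b) =
        FreeAlgebra.ι R (n, y) * D b + FreeAlgebra.ι R (n + 1, y) * b := by
  let A := FreeAlgebra R (ℕ × Y)
  let f : A →ₐ[R] TrivSqZeroExt A A := FreeAlgebra.lift R fun t =>
    TrivSqZeroExt.inl (FreeAlgebra.ι R t) + TrivSqZeroExt.inr (FreeAlgebra.ι R (t.1 + 1, t.2))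
  have hfst : ∀ b, (f b).fst = b := by
    intro b
    have : (TrivSqZeroExt.fstHom R A A).comp f = AlgHom.id R A := by
      ext t
      simp [f, A]
    exact DFunLike.congr_fun this b
  refine ⟨{ toFun b := (f b).snd, map_add' := by simp, map_smul' := by simp }, ?_, ?_⟩
  · simp
  · intro n y b
    have h : f (FreeAlgebra.ι R (n, y)) = TrivSqZeroExt.inl (FreeAlgebra.ι R (n, y)) +
      TrivSqZeroExt.inr (FreeAlgebra.ι R (n + 1, y)) := FreeAlgebra.lift_ι_apply _ _
    simp [h, hfst, TrivSqZeroExt.snd_mul]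

/-- Lazard elimination: the element `i₀` is linearly independent of the free subalgebra generated
by the iterated commutators of `i₀` with the other letters. -/
theorem eq_zero_of_smul_ι_add_elimHom (R : Type*) [CommRing R] {ι : Type} (i₀ : ι) {r : R}
    {a : FreeAlgebra R (ℕ × {y : ι // y ≠ i₀})}
    (h : r • FreeAlgebra.ι R i₀ + elimHom R i₀ a = 0) : r = 0 ∧ a = 0 := by
  classical
  obtain ⟨D, hD1, hD⟩ := exists_shift_derivation R {y : ι // y ≠ i₀}
  let ρ : FreeAlgebra R ι →ₐ[R] Module.End R (FreeAlgebra R (ℕ × {y : ι // y ≠ i₀})) :=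
    FreeAlgebra.lift R fun i =>
      if hi : i = i₀ then D else LinearMap.mulLeft R (FreeAlgebra.ι R (0, ⟨i, hi⟩))
  have hρ₀ : ρ (FreeAlgebra.ι R i₀) = D := by simp [ρ]
  have hρ : ρ.comp (elimHom R i₀) = Algebra.lmul R _ := by
    ext1
    funext ⟨n, y⟩
    simp only [Function.comp_apply, AlgHom.coe_comp, elimHom, FreeAlgebra.lift_ι_apply]
    induction n with
    | zero =>
      ext1 b
      simp [ρ, y.2]
    | succ n ih =>
      rw [Function.iterate_succ_apply', map_sub, map_mul, map_mul, ih, hρ₀]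
      ext1 b
      simp [hD]
  have ha : a = 0 := by
    have h1 := congrArg (fun z => ρ z 1) h
    have h2 : ρ (elimHom R i₀ a) = Algebra.lmul R _ a := DFunLike.congr_fun hρ a
    simpa [hρ₀, hD1, h2] using h1
  refine ⟨?_, ha⟩
  rw [ha, map_zero, add_zero] at h
  simpa using congrArg (FreeAlgebra.lift R fun _ : ι => (1 : R)) h

variable {p : ℕ} {G : Type*} [Group G] {ι : Type} {x : ι → G} {w : ι → ℕ} {i₀ : ι}

theorem elimGen_mem (hx : ∀ i, x i ∈ lambdaP p G (w i)) (t : ℕ × {y : ι // y ≠ i₀}) :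
    elimGen x i₀ t ∈ lambdaP p G (elimDeg w i₀ t) := by
  obtain ⟨n, y⟩ := t
  induction n with
  | zero => simpa [elimGen, elimDeg] using hx y
  | succ n ih =>
    have := commutator_mem_lambdaP (hx i₀) ih
    simp only [elimGen, elimDeg, Function.iterate_succ_apply'] at this ⊢
    convert! this using 1
    congr 1
    ring

/-- Commutation with the eliminated generator preserves the symbols in the remaining letters. -/
theorem LieSymbol.exists_commutator_elimGen (hodd : Odd p)
    (hx : ∀ i, x i ∈ lambdaP p G (w i)) {k : ℕ} {h : G}
    {b : FreeAlgebra (ZMod p) (ℕ × {y : ι // y ≠ i₀})}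
    (hh : LieSymbol p (elimGen x i₀) (elimDeg w i₀) k h b) :
    ∃ b', LieSymbol p (elimGen x i₀) (elimDeg w i₀) (w i₀ + k + 1) ⁅x i₀, h⁆ b' ∧
      elimHom (ZMod p) i₀ b' = FreeAlgebra.ι (ZMod p) i₀ * elimHom (ZMod p) i₀ b -
        elimHom (ZMod p) i₀ b * FreeAlgebra.ι (ZMod p) i₀ := by
  have hx' := elimGen_mem (i₀ := i₀) hx
  induction hh with
  | of t =>
    obtain ⟨n, y⟩ := t
    refine ⟨FreeAlgebra.ι _ (n + 1, y), ?_, ?_⟩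
    · have := LieSymbol.of (p := p) (x := elimGen x i₀) (w := elimDeg w i₀) (n + 1, y)
      have h1 : elimGen x i₀ (n + 1, y) = ⁅x i₀, elimGen x i₀ (n, y)⁆ := by
        simp only [elimGen, Function.iterate_succ_apply']
      rw [h1] at this
      refine this.cast ?_
      simp only [elimDeg]
      ring
    · simp only [elimHom, FreeAlgebra.lift_ι_apply, Function.iterate_succ_apply']
  | zero hg =>
    exact ⟨0, .zero (lambdaP_antitone (by omega) (commutator_mem_lambdaP (hx i₀) hg)), by simp⟩
  | @mul k g h _ _ hg hh ih1 ih2 =>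
    obtain ⟨b₁, h1, e1⟩ := ih1
    obtain ⟨b₂, h2, e2⟩ := ih2
    refine ⟨b₁ + b₂, (h1.mul h2).congr ?_, ?_⟩
    · exact (lambdaP_mk_commutator_mul_right (hx i₀) (hh.mem hx')).symm
    · simp only [map_add, e1, e2]
      noncomm_ring
  | pow hg ih =>
    obtain ⟨b₁, h1, e1⟩ := ih
    exact ⟨b₁, h1.pow.congr (lambdaP_mk_commutator_pow_right hodd (hx i₀) (hg.mem hx')).symm, e1⟩
  | @commutator i j g h a b hg hh ih1 ih2 =>
    obtain ⟨b₁, h1, e1⟩ := ih1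
    obtain ⟨b₂, h2, e2⟩ := ih2
    refine ⟨(b₁ * b - b * b₁) + (a * b₂ - b₂ * a),
      (((h1.commutator hh).cast (k' := w i₀ + i + j + 2) (by ring)).mul
        ((hg.commutator h2).cast (by ring))).congr
      (lambdaP_mk_commutator_commutator (hx i₀) (hg.mem hx') (hh.mem hx')).symm |>.cast
        (by ring), ?_⟩
    simp only [map_add, map_sub, map_mul, e1, e2]
    noncomm_ring

/-- Commutation with powers of the eliminated generator preserves the symbols in the remaining
letters. -/
theorem LieSymbol.exists_pow_commutator_elimGen (hodd : Odd p)
    (hx : ∀ i, x i ∈ lambdaP p G (w i)) {k : ℕ} {h : G}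
    {b : FreeAlgebra (ZMod p) (ℕ × {y : ι // y ≠ i₀})}
    (hh : LieSymbol p (elimGen x i₀) (elimDeg w i₀) k h b) (c j : ℕ) :
    ∃ b', LieSymbol p (elimGen x i₀) (elimDeg w i₀) (w i₀ + j + k + 1) ⁅x i₀ ^ (p ^ j * c), h⁆ b' ∧
      elimHom (ZMod p) i₀ b' = (c : ZMod p) •
        (FreeAlgebra.ι (ZMod p) i₀ * elimHom (ZMod p) i₀ b -
          elimHom (ZMod p) i₀ b * FreeAlgebra.ι (ZMod p) i₀) := by
  have hx' := elimGen_mem (i₀ := i₀) hx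
  obtain ⟨b₁, h1, e1⟩ := LieSymbol.exists_commutator_elimGen hodd hx hh
  have h2 : ∀ j : ℕ, LieSymbol p (elimGen x i₀) (elimDeg w i₀) (w i₀ + j + k + 1)
      ⁅x i₀ ^ p ^ j, h⁆ b₁ := by
    intro j
    induction j with
    | zero => simpa using h1
    | succ j ih =>
      rw [pow_succ, pow_mul]
      exact ((ih.pow).congr (lambdaP_mk_commutator_pow_left hodd (pow_pow_mem_lambdaP (hx i₀) j)
        (hh.mem hx')).symm).cast (by ring)
  have h3 : LieSymbol p (elimGen x i₀) (elimDeg w i₀) (w i₀ + j + k + 1)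
      ⁅x i₀ ^ (p ^ j * c), h⁆ (c • b₁) := by
    induction c with
    | zero => simpa using LieSymbol.zero (one_mem _)
    | succ c ih =>
      rw [mul_add, mul_one, pow_add, succ_nsmul]
      exact (ih.mul (h2 j)).congr
        (lambdaP_mk_commutator_mul_left (pow_pow_mem_lambdaP (hx i₀) j) (hh.mem hx')).symm
  exact ⟨_, h3, by rw [map_nsmul, e1, Nat.cast_smul_eq_nsmul]⟩

/-- Every symbol splits as a power of the eliminated generator times a symbol in the remaining
letters. -/
theorem LieSymbol.exists_elim (hodd : Odd p) (hx : ∀ i, x i ∈ lambdaP p G (w i)) (i₀ : ι)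
    {k : ℕ} {g : G} {a : FreeAlgebra (ZMod p) ι} (hg : LieSymbol p x w k g a) :
    ∃ (c : ℕ) (h : G) (b : _), (k < w i₀ → c = 0) ∧
      (g : G ⧸ lambdaP p G (k + 1)) = (x i₀ ^ (p ^ (k - w i₀) * c) * h : G) ∧
      LieSymbol p (elimGen x i₀) (elimDeg w i₀) k h b ∧
      a = (c : ZMod p) • FreeAlgebra.ι (ZMod p) i₀ + elimHom (ZMod p) i₀ b := by
  classical
  have hx' := elimGen_mem (i₀ := i₀) hx
  have hpow : ∀ {k c : ℕ}, (k < w i₀ → c = 0) →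
      x i₀ ^ (p ^ (k - w i₀) * c) ∈ lambdaP p G k := by
    intro k c hc
    by_cases hk : k < w i₀
    · rw [hc hk, mul_zero, pow_zero]
      exact one_mem _
    · obtain ⟨j, rfl⟩ := Nat.exists_eq_add_of_le (not_lt.1 hk)
      rw [Nat.add_sub_cancel_left, pow_mul]
      exact pow_mem (pow_pow_mem_lambdaP (hx i₀) j) c
  have hcomm : ∀ {i c : ℕ}, (i < w i₀ → c = 0) → ∀ {j : ℕ} {h : G} {b},
      LieSymbol p (elimGen x i₀) (elimDeg w i₀) j h b →
      ∃ b', LieSymbol p (elimGen x i₀) (elimDeg w i₀) (i + j + 1)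
        ⁅x i₀ ^ (p ^ (i - w i₀) * c), h⁆ b' ∧ elimHom (ZMod p) i₀ b' = (c : ZMod p) •
          (FreeAlgebra.ι (ZMod p) i₀ * elimHom (ZMod p) i₀ b -
            elimHom (ZMod p) i₀ b * FreeAlgebra.ι (ZMod p) i₀) := by
    intro i c hc j h b hb
    by_cases hi : i < w i₀
    · exact ⟨0, by simpa [hc hi] using LieSymbol.zero (one_mem _), by simp [hc hi]⟩
    · obtain ⟨b', s, e⟩ := LieSymbol.exists_pow_commutator_elimGen hodd hx hb c (i - w i₀)
      exact ⟨b', s.cast (by omega), e⟩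
  induction hg with
  | of i =>
    by_cases hi : i = i₀
    · subst hi
      exact ⟨1, 1, 0, by simp, by simp, .zero (one_mem _), by simp⟩
    · refine ⟨0, x i, FreeAlgebra.ι _ (0, ⟨i, hi⟩), by simp, by simp, ?_, ?_⟩
      · have := LieSymbol.of (p := p) (x := elimGen x i₀) (w := elimDeg w i₀) (0, ⟨i, hi⟩)
        simpa [elimDeg, elimGen] using this
      · simp [elimHom]
  | zero hg => exact ⟨0, 1, 0, by simp, by simpa using hg, .zero (one_mem _), by simp⟩
  | @mul k g₁ g₂ a₁ a₂ hg₁ hg₂ ih1 ih2 =>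
    obtain ⟨c₁, h₁, b₁, hc₁, e₁, s₁, rfl⟩ := ih1
    obtain ⟨c₂, h₂, b₂, hc₂, e₂, s₂, rfl⟩ := ih2
    refine ⟨c₁ + c₂, h₁ * h₂, b₁ + b₂, fun hk => by rw [hc₁ hk, hc₂ hk], ?_, s₁.mul s₂, ?_⟩
    · have hcomm := lambdaP_quotient_commute (s₁.mem hx')
        (x i₀ ^ (p ^ (k - w i₀) * c₂) : G)
      rw [QuotientGroup.mk_mul, e₁, e₂, mul_add, pow_add]
      simp only [QuotientGroup.mk_mul]
      rw [mul_assoc, hcomm.left_comm, ← mul_assoc]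
    · rw [map_add, Nat.cast_add, add_smul]
      abel
  | @pow k g a hg ih =>
    obtain ⟨c, h, b, hc, e, s, rfl⟩ := ih
    refine ⟨c, h ^ p, b, fun hk => hc (by omega), ?_, s.pow, rfl⟩
    have hy := hpow hc
    have hh := s.mem hx'
    have hyp : (x i₀ ^ (p ^ (k - w i₀) * c)) ^ p = x i₀ ^ (p ^ (k + 1 - w i₀) * c) := by
      by_cases hk : k < w i₀
      · simp [hc hk]
      · rw [← pow_mul, Nat.succ_sub (not_lt.1 hk), pow_succ]
        congr 1
        ring
    have hg' := hg.mem hx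
    rw [lambdaP_mk_pow_congr hodd hg' e, lambdaP_mk_mul_pow hodd hy hh, hyp]
  | @commutator i j g₁ g₂ a₁ a₂ hg₁ hg₂ ih1 ih2 =>
    obtain ⟨c₁, h₁, b₁, hc₁, e₁, s₁, rfl⟩ := ih1
    obtain ⟨c₂, h₂, b₂, hc₂, e₂, s₂, rfl⟩ := ih2
    obtain ⟨b₃, s₃, e₃⟩ := hcomm hc₁ s₂
    obtain ⟨b₄, s₄, e₄⟩ := hcomm hc₂ s₁
    have hy₁ := hpow hc₁
    have hy₂ := hpow hc₂
    have hh₁ := s₁.mem hx'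
    have hh₂ := s₂.mem hx'
    have hyy : Commute (x i₀ ^ (p ^ (i - w i₀) * c₁)) (x i₀ ^ (p ^ (j - w i₀) * c₂)) :=
      (Commute.refl _).pow_pow _ _
    refine ⟨0, _, _, fun _ => rfl, ?_,
      s₃.mul (((s₄.cast (by ring)).inv hodd.pos hx').mul (s₁.commutator s₂)), ?_⟩
    · rw [lambdaP_mk_commutator_congr (hg₁.mem hx) (hg₂.mem hx) e₁ e₂,
        lambdaP_mk_commutator_mul_left hh₁ (mul_mem hy₂ hh₂), QuotientGroup.mk_mul,
        lambdaP_mk_commutator_mul_right hy₁ hh₂, lambdaP_mk_commutator_mul_right hh₁ hh₂,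
        commutatorElement_eq_one_iff_commute.2 hyy, commutatorElement_inv]
      simp
    · simp only [map_add, map_neg, map_sub, map_mul, e₃, e₄, Nat.cast_zero, zero_smul, zero_add,
        add_mul, mul_add, smul_mul_assoc, mul_smul_comm, smul_sub, smul_add]
      rw [smul_comm (c₁ : ZMod p) (c₂ : ZMod p)]
      abel

/-- An element with vanishing symbol lies in the next term of the lower `p`-series. The letters of
least degree are eliminated one at a time until all letters have degree larger than `k`. -/
theorem LieSymbol.mem_succ_of_zero (hp : p.Prime) (hodd : Odd p) {k : ℕ} {g : G}
    (hx : ∀ i, x i ∈ lambdaP p G (w i)) (hw : ∀ n, {i | w i = n}.Finite)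
    (hg : LieSymbol p x w k g 0) : g ∈ lambdaP p G (k + 1) := by
  have := Fact.mk hp
  suffices H : ∀ (r m : ℕ), k < m + r → ∀ (c : ℕ) {ι : Type} (x : ι → G) (w : ι → ℕ) (g : G),
      (∀ i, x i ∈ lambdaP p G (w i)) → (∀ n, {i | w i = n}.Finite) → (∀ i, m ≤ w i) →
      {i | w i = m}.ncard ≤ c → LieSymbol p x w k g 0 → g ∈ lambdaP p G (k + 1) from
    H (k + 1) 0 (by omega) _ x w g hx hw (fun _ => Nat.zero_le _) le_rfl hg
  clear hg hw hx
  intro r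
  induction r with
  | zero =>
    intro m hm c ι x w g hx _ hwm _ hg
    exact hg.mem_succ_of_lt hx fun i => lt_of_lt_of_le (by omega) (hwm i)
  | succ r ihr =>
    intro m hm c
    induction c with
    | zero =>
      intro ι x w g hx hw hwm hc hg
      refine ihr (m + 1) (by omega) _ x w g hx hw (fun i => ?_) le_rfl hg
      refine lt_of_le_of_ne (hwm i) fun hi => ?_
      have := (Set.ncard_eq_zero (hw m)).1 (Nat.le_zero.1 hc)
      exact (Set.eq_empty_iff_forall_notMem.1 this i) hi.symm
    | succ c ihc =>
      intro ι x w g hx hw hwm hc hg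
      by_cases hi₀ : ∃ i₀, w i₀ = m
      · obtain ⟨i₀, rfl⟩ := hi₀
        obtain ⟨n, h, b, hn, e, s, hsum⟩ := hg.exists_elim hodd hx i₀
        obtain ⟨hn0, rfl⟩ := eq_zero_of_smul_ι_add_elimHom (ZMod p) i₀ hsum.symm
        have hh : h ∈ lambdaP p G (k + 1) := by
          refine ihc _ _ h (elimGen_mem hx) (fun n => ?_)
            (fun t => (hwm t.2).trans (Nat.le_add_right _ _)) ?_ s
          · have hfin : {i | w i ≤ n}.Finite := by
              have : {i | w i ≤ n} = ⋃ l ∈ Set.Iic n, {i | w i = l} := by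
                ext i
                simp
              rw [this]
              exact (Set.finite_Iic n).biUnion fun l _ => hw l
            refine ((Set.finite_Iic n).prod (hfin.preimage
              (Subtype.val_injective.injOn (s := _)))).subset ?_
            rintro ⟨l, y⟩ hl
            simp only [elimDeg, Set.mem_ofPred_eq] at hl
            simp only [Set.mem_prod, Set.mem_Iic, Set.mem_preimage, Set.mem_ofPred_eq]
            constructor <;> nlinarith
          · have hlt : ({i | w i = w i₀} \ {i₀}).ncard ≤ c := by
              rw [Set.ncard_sdiff_singleton_of_mem (by simp)]
              omega
            refine le_trans (Set.ncard_le_ncard_of_injOn (fun t => (t.2 : ι)) ?_ ?_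
              ((hw _).subset Set.sdiff_subset)) hlt
            · rintro ⟨l, y⟩ hl
              simp only [elimDeg, Set.mem_ofPred_eq] at hl
              have := hwm y
              exact ⟨by simp only [Set.mem_ofPred_eq]; nlinarith, y.2⟩
            · rintro ⟨l, y⟩ hl ⟨l', y'⟩ hl' hyy
              simp only [elimDeg, Set.mem_ofPred_eq] at hl hl'
              have h1 := hwm y
              have h2 := hwm y'
              have hl0 : l = 0 := by
                by_contra h
                have := Nat.le_mul_of_pos_left (w i₀ + 1) (Nat.pos_of_ne_zero h)
                omega
              have hl0' : l' = 0 := by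
                by_contra h
                have := Nat.le_mul_of_pos_left (w i₀ + 1) (Nat.pos_of_ne_zero h)
                omega
              exact Prod.ext (hl0.trans hl0'.symm) (Subtype.ext hyy)
        have hy : x i₀ ^ (p ^ (k - w i₀) * n) ∈ lambdaP p G (k + 1) := by
          by_cases hk : k < w i₀
          · rw [hn hk, mul_zero, pow_zero]
            exact one_mem _
          · obtain ⟨n', rfl⟩ := (ZMod.natCast_eq_zero_iff n p).1 hn0
            rw [← mul_assoc, pow_mul, ← pow_succ]
            have := pow_pow_mem_lambdaP (hx i₀) (k - w i₀ + 1)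
            rw [show w i₀ + (k - w i₀ + 1) = k + 1 by omega] at this
            exact pow_mem this _
        rw [← QuotientGroup.eq_one_iff, e, QuotientGroup.eq_one_iff]
        exact mul_mem hy hh
      · refine ihr (m + 1) (by omega) _ x w g hx hw (fun i => ?_) le_rfl hg
        exact lt_of_le_of_ne (hwm i) fun hi => hi₀ ⟨i, hi.symm⟩

end Elimination

section MagnusExpansion

open scoped commutatorElement

variable {p : ℕ} {G : Type*} [Group G] {A B : Type*} [Ring A] [Ring B]

/-- The elements of `G` congruent to `1` modulo `p ^ n` under a multiplicative representation. -/
def magnusSubgroup (p : ℕ) (μ : G →* A) (n : ℕ) : Subgroup G where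
  carrier := {g | ∃ u, μ g = 1 + (p : A) ^ n * u}
  one_mem' := ⟨0, by simp⟩
  mul_mem' := by
    rintro g h ⟨u, hu⟩ ⟨v, hv⟩
    refine ⟨u + v + u * ((p : A) ^ n * v), ?_⟩
    rw [map_mul, hu, hv]
    noncomm_ring
  inv_mem' := by
    rintro g ⟨u, hu⟩
    refine ⟨-(u * μ g⁻¹), ?_⟩
    have : μ g * μ g⁻¹ = 1 := by rw [← map_mul, mul_inv_cancel, map_one]
    rw [hu, add_mul, one_mul] at this
    rw [mul_neg, ← sub_eq_add_neg, ← mul_assoc]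
    exact eq_sub_of_add_eq this

theorem exists_one_add_pow_eq (z : A) (n : ℕ) :
    ∃ s, (1 + z) ^ n = 1 + n * z + (∑ i ∈ Finset.range n, i : ℕ) * z ^ 2 + z ^ 3 * s := by
  induction n with
  | zero => exact ⟨0, by simp⟩
  | succ n ih =>
    obtain ⟨s, hs⟩ := ih
    refine ⟨(∑ i ∈ Finset.range n, i : ℕ) + s + s * z, ?_⟩
    rw [pow_succ, hs, Finset.sum_range_succ]
    generalize ∑ i ∈ Finset.range n, i = m
    have h1 : (m : A) * (z * (z * z)) = z * (z * (z * m)) := by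
      have := (Nat.cast_commute m (z ^ 3)).eq
      rw [pow_succ, sq] at this
      simpa only [mul_assoc] using this
    push_cast
    simp only [mul_add, add_mul, pow_succ, pow_zero, mul_one, one_mul, mul_assoc, h1]
    abel

theorem exists_one_add_natCast_pow_mul_pow_eq (hodd : Odd p) (k : ℕ) (u : A) :
    ∃ s, (1 + (p : A) ^ (k + 1) * u) ^ p = 1 + (p : A) ^ (k + 2) * (u + p * s) := by
  obtain ⟨s, hs⟩ := exists_one_add_pow_eq ((p : A) ^ (k + 1) * u) p
  obtain ⟨m, hm⟩ := hodd
  have hsum : ∑ i ∈ Finset.range p, i = p * m := by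
    rw [Finset.sum_range_id]
    apply Nat.div_eq_of_eq_mul_left two_pos
    rw [hm, Nat.add_sub_cancel]
    ring
  have hc : Commute ((p : A) ^ (k + 1)) u := (Nat.cast_commute p u).pow_left _
  refine ⟨(p : A) ^ k * (m * u ^ 2) + (p : A) ^ (2 * k) * (u ^ 3 * s), ?_⟩
  have e1 : (p : A) * ((p : A) ^ (k + 1) * u) = (p : A) ^ (k + 2) * u := by
    rw [← mul_assoc, ← pow_succ']
  have e2 : ((p * m : ℕ) : A) * ((p : A) ^ (2 * (k + 1)) * u ^ 2) =
      (p : A) ^ (k + 2) * (p * ((p : A) ^ k * (m * u ^ 2))) := by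
    rw [Nat.cast_mul, mul_assoc, ← mul_assoc (m : A), (Nat.cast_commute m _).eq, mul_assoc]
    simp only [← mul_assoc, ← pow_succ', ← pow_add]
    congr 3
    ring
  have e3 : (p : A) ^ (3 * (k + 1)) * u ^ 3 * s =
      (p : A) ^ (k + 2) * (p * ((p : A) ^ (2 * k) * (u ^ 3 * s))) := by
    simp only [← mul_assoc, ← pow_succ, ← pow_add]
    congr 3
    ring
  rw [hs, hsum, hc.mul_pow, hc.mul_pow, ← pow_mul, ← pow_mul, mul_comm (k + 1) 2,
    mul_comm (k + 1) 3, e1, e2, e3]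
  noncomm_ring

theorem map_commutatorElement_eq {μ : G →* A} {i j : ℕ} {g h : G} {u v : A}
    (hu : μ g = 1 + (p : A) ^ (i + 1) * u) (hv : μ h = 1 + (p : A) ^ (j + 1) * v) :
    μ ⁅g, h⁆ = 1 + (p : A) ^ (i + j + 1 + 1) * ((u * v - v * u) * (μ g⁻¹ * μ h⁻¹)) := by
  have h1 : μ ⁅g, h⁆ = 1 + (μ g * μ h - μ h * μ g) * (μ g⁻¹ * μ h⁻¹) := by
    rw [sub_mul]
    simp only [← map_mul]
    rw [show h * g * (g⁻¹ * h⁻¹) = 1 by group, map_one, add_sub_cancel, commutatorElement_def,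
      mul_assoc (g * h)]
  have hq : ∀ (n : ℕ) (a : A), a * (p : A) ^ n = (p : A) ^ n * a := fun n a =>
    ((Nat.cast_commute p a).pow_left n).eq.symm
  have h2 : μ g * μ h - μ h * μ g = (p : A) ^ (i + j + 1 + 1) * (u * v - v * u) := by
    have e1 : (p : A) ^ (i + 1) * u * ((p : A) ^ (j + 1) * v) =
        (p : A) ^ (i + j + 1 + 1) * (u * v) := by
      rw [mul_assoc, ← mul_assoc u, hq, mul_assoc, ← mul_assoc, ← pow_add]
      congr 2
      ring
    have e2 : (p : A) ^ (j + 1) * v * ((p : A) ^ (i + 1) * u) =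
        (p : A) ^ (i + j + 1 + 1) * (v * u) := by
      rw [mul_assoc, ← mul_assoc v, hq, mul_assoc, ← mul_assoc, ← pow_add]
      congr 2
      ring
    rw [hu, hv, mul_sub, ← e1, ← e2]
    noncomm_ring
  rw [h1, h2, mul_assoc]

theorem lambdaP_le_magnusSubgroup (hodd : Odd p) {μ : G →* A} (hμ : magnusSubgroup p μ 1 = ⊤)
    (k : ℕ) : lambdaP p G k ≤ magnusSubgroup p μ (k + 1) := by
  induction k with
  | zero => exact hμ.ge
  | succ k ih =>
    refine sup_le ?_ ?_
    · rw [Subgroup.commutator_le]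
      intro g hg h hh
      obtain ⟨u, hu⟩ := ih hg
      obtain ⟨v, hv⟩ := hμ.ge hh
      exact ⟨_, map_commutatorElement_eq (j := 0) hu hv⟩
    · rw [Subgroup.closure_le]
      rintro _ ⟨g, hg, rfl⟩
      obtain ⟨u, hu⟩ := ih hg
      obtain ⟨s, hs⟩ := exists_one_add_natCast_pow_mul_pow_eq hodd k u
      exact ⟨_, by rw [map_pow, hu, hs]⟩

variable {ι : Type} {x : ι → G}

/-- The symbol of an element is the leading coefficient of its `p`-adic expansion. -/
theorem LieSymbol.exists_expansion (hodd : Odd p) {μ : G →* A} (hμ : magnusSubgroup p μ 1 = ⊤)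
    {red : A →+* B} (hB : (p : B) = 0) {θ : FreeAlgebra (ZMod p) ι →+* B}
    (hx : ∀ i, ∃ u, μ (x i) = 1 + (p : A) * u ∧ red u = θ (FreeAlgebra.ι (ZMod p) i))
    {k : ℕ} {g : G} {a : FreeAlgebra (ZMod p) ι} (hg : LieSymbol p x (fun _ => 0) k g a) :
    ∃ u, μ g = 1 + (p : A) ^ (k + 1) * u ∧ red u = θ a := by
  have hred : ∀ g, red (μ g) = 1 := by
    intro g
    obtain ⟨u, hu⟩ := hμ.ge (Subgroup.mem_top g)
    simp [hu, hB]
  induction hg with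
  | of i => simpa using hx i
  | @zero k g hg =>
    obtain ⟨u, hu⟩ := lambdaP_le_magnusSubgroup hodd hμ _ hg
    exact ⟨p * u, by rw [hu, pow_succ _ (k + 1), mul_assoc], by simp [hB]⟩
  | @mul k g h a b _ _ ih1 ih2 =>
    obtain ⟨u, hu, eu⟩ := ih1
    obtain ⟨v, hv, ev⟩ := ih2
    refine ⟨u + v + u * ((p : A) ^ (k + 1) * v), ?_, by simp [hB, eu, ev]⟩
    rw [map_mul, hu, hv]
    noncomm_ring
  | @pow k g a _ ih =>
    obtain ⟨u, hu, eu⟩ := ih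
    obtain ⟨s, hs⟩ := exists_one_add_natCast_pow_mul_pow_eq hodd k u
    exact ⟨u + p * s, by rw [map_pow, hu, hs], by simp [hB, eu]⟩
  | commutator _ _ ih1 ih2 =>
    obtain ⟨u, hu, eu⟩ := ih1
    obtain ⟨v, hv, ev⟩ := ih2
    exact ⟨_, map_commutatorElement_eq hu hv, by simp [hred, eu, ev]⟩

end MagnusExpansion

section FreeGroup

variable {p : ℕ} {ι : Type}

theorem castHom_eq_zero_of_pow_mul_eq_zero (hp : 0 < p) (n : ℕ) {a : ZMod (p ^ (n + 1))}
    (h : (p : ZMod (p ^ (n + 1))) ^ n * a = 0) :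
    ZMod.castHom (dvd_pow_self p n.succ_ne_zero) (ZMod p) a = 0 := by
  have : NeZero (p ^ (n + 1)) := ⟨(pow_pos hp _).ne'⟩
  obtain ⟨m, rfl⟩ := ZMod.natCast_zmod_surjective a
  rw [← Nat.cast_pow, ← Nat.cast_mul, ZMod.natCast_eq_zero_iff, pow_succ] at h
  rw [map_natCast, ZMod.natCast_eq_zero_iff]
  exact Nat.dvd_of_mul_dvd_mul_left (pow_pos hp n) h

/-- The symbol of an element of the free group is well defined: it vanishes on elements of the next
term of the lower `p`-series. -/
theorem LieSymbol.eq_zero_of_mem_succ (hp : 0 < p) (hodd : Odd p) {k : ℕ} {g : FreeGroup ι}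
    {a : FreeAlgebra (ZMod p) ι} (hg : LieSymbol p FreeGroup.of (fun _ => 0) k g a)
    (hgk : g ∈ lambdaP p (FreeGroup ι) (k + 1)) : a = 0 := by
  let N := p ^ (k + 1 + 1)
  let A := MonoidAlgebra (ZMod N) (FreeMonoid ι)
  let red : A →+* MonoidAlgebra (ZMod p) (FreeMonoid ι) :=
    MonoidAlgebra.mapRingHom _ (ZMod.castHom (dvd_pow_self p (k + 1).succ_ne_zero) (ZMod p))
  let θ := (FreeAlgebra.equivMonoidAlgebraFreeMonoid (R := ZMod p) (X := ι))
  have hA : (p : A) ^ (k + 1 + 1) = 0 := by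
    have := congrArg (algebraMap (ZMod N) A) (ZMod.natCast_self N)
    rwa [map_zero, map_natCast, Nat.cast_pow] at this
  have hB : (p : MonoidAlgebra (ZMod p) (FreeMonoid ι)) = 0 := by
    have := congrArg (algebraMap (ZMod p) (MonoidAlgebra (ZMod p) (FreeMonoid ι)))
      (ZMod.natCast_self p)
    rwa [map_zero, map_natCast] at this
  let X : ι → A := fun i => MonoidAlgebra.single (FreeMonoid.of i) 1
  have hunit : ∀ i, IsUnit (1 + (p : A) * X i) := fun i =>
    IsNilpotent.isUnit_one_add ⟨k + 1 + 1, by rw [(Nat.cast_commute p (X i)).mul_pow, hA, zero_mul]⟩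
  let μ : FreeGroup ι →* A := (Units.coeHom A).comp (FreeGroup.lift fun i => (hunit i).unit)
  have hμx : ∀ i, μ (FreeGroup.of i) = 1 + (p : A) * X i := fun i => by simp [μ]
  have hμ : magnusSubgroup p μ 1 = ⊤ := by
    rw [eq_top_iff, ← FreeGroup.closure_range_of, Subgroup.closure_le]
    rintro _ ⟨i, rfl⟩
    exact ⟨X i, by rw [hμx, pow_one]⟩
  obtain ⟨u, hu, eu⟩ := hg.exists_expansion hodd hμ (red := red) (θ := (θ : _ →+* _)) hB
    fun i => ⟨X i, hμx i, (MonoidAlgebra.mapRingHom_single _ _ _).trans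
      (by simp [θ, FreeAlgebra.equivMonoidAlgebraFreeMonoid])⟩
  obtain ⟨v, hv⟩ := lambdaP_le_magnusSubgroup hodd hμ _ hgk
  have hz : (p : A) ^ (k + 1) * u = 0 := by
    rw [hA, zero_mul, hu] at hv
    exact add_left_cancel hv
  have hru : red u = 0 := by
    ext m
    rw [← Nat.cast_pow, ← nsmul_eq_mul] at hz
    have := congrArg (fun z => MonoidAlgebra.coeff z m) hz
    refine castHom_eq_zero_of_pow_mul_eq_zero hp (k + 1) ?_
    rw [← Nat.cast_pow, ← nsmul_eq_mul]
    exact this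
  rw [hru] at eu
  exact (map_eq_zero_iff θ θ.injective).1 eu.symm

end FreeGroup

section Quotients

variable {p : ℕ}

theorem FreeGroup.mem_lambdaP_of_pow_mem {ι : Type} [Finite ι] (hp : p.Prime) (hodd : Odd p)
    {k : ℕ} {g : FreeGroup ι} (hg : g ^ p ∈ lambdaP p (FreeGroup ι) (k + 1)) :
    g ∈ lambdaP p (FreeGroup ι) k := by
  induction k with
  | zero => exact Subgroup.mem_top g
  | succ k ih =>
    have hgk := ih (lambdaP_antitone (Nat.le_succ _) hg)
    obtain ⟨a, ha⟩ := LieSymbol.exists_of_mem (x := FreeGroup.of) (w := fun _ => 0) (fun _ => rfl)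
      hp.pos (FreeGroup.closure_range_of ι) hgk
    obtain rfl := ha.pow.eq_zero_of_mem_succ hp.pos hodd hg
    exact ha.mem_succ_of_zero hp hodd (fun _ => Subgroup.mem_top _) fun _ => Set.toFinite _

theorem finiteIndex_lambdaP (hp : 0 < p) {G : Type*} [Group G] [Group.FG G] (k : ℕ) :
    (lambdaP p G k).FiniteIndex := by
  induction k with
  | zero => exact (inferInstance : (⊤ : Subgroup G).FiniteIndex)
  | succ k ih =>
    have hfg : Group.FG (lambdaP p G k) := inferInstance
    let K := (lambdaP p G (k + 1)).subgroupOf (lambdaP p G k)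
    let _ : CommGroup (lambdaP p G k ⧸ K) :=
      { (inferInstance : Group (lambdaP p G k ⧸ K)) with
        mul_comm := fun a b => by
          induction a using QuotientGroup.induction_on with
          | H a =>
            induction b using QuotientGroup.induction_on with
            | H b =>
              refine QuotientGroup.eq.2 (Subgroup.mem_subgroupOf.2 ?_)
              have := lambdaP_antitone (by omega : k + 1 ≤ k + k + 1)
                (commutator_mem_lambdaP (inv_mem b.2) (inv_mem a.2))
              simpa [commutatorElement_def, mul_assoc] using this }
    have htors : IsMulTorsion (lambdaP p G k ⧸ K) := by
      intro a
      induction a using QuotientGroup.induction_on with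
      | H a =>
        refine isOfFinOrder_iff_pow_eq_one.2 ⟨p, hp, (QuotientGroup.eq_one_iff (a ^ p)).2 ?_⟩
        exact Subgroup.mem_subgroupOf.2 (pow_mem_lambdaP a.2)
    have hfin : Finite (lambdaP p G k ⧸ K) := CommGroup.finite_of_fg_isMulTorsion _ htors
    refine ⟨?_⟩
    rw [← Subgroup.relIndex_mul_index (lambdaP_antitone (Nat.le_succ k))]
    exact mul_ne_zero (Subgroup.index_ne_zero_of_finite (H := K)) ih.index_ne_zero

end Quotients

/-- **Theorem 3.1** (Bubboloni–Corsi Tani).  For an odd prime `p`, positive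
integers `d`, `n`, and `F` the free group on `d` generators, the quotient
`G_n = F / λ_{n+1}^p(F)` is a finite `p`-group which is `p`-central (every
element of order `p` is central); more precisely
`Ω_1(G_n) = λ_n^p(F) / λ_{n+1}^p(F)`. -/
theorem quotient_lowerPSeries_p_central (p : ℕ) (hp : p.Prime) (hodd : Odd p)
    (d n : ℕ) (hd : 0 < d) (hn : 0 < n)
    [(lambdaP p (FreeGroup (Fin d)) n).Normal] :
    Finite (FreeGroup (Fin d) ⧸ lambdaP p (FreeGroup (Fin d)) n) ∧
      IsPGroup p (FreeGroup (Fin d) ⧸ lambdaP p (FreeGroup (Fin d)) n) ∧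
      (∀ g : FreeGroup (Fin d) ⧸ lambdaP p (FreeGroup (Fin d)) n,
        orderOf g = p → g ∈ Subgroup.center (FreeGroup (Fin d) ⧸ lambdaP p (FreeGroup (Fin d)) n)) ∧
      Subgroup.closure {g : FreeGroup (Fin d) ⧸ lambdaP p (FreeGroup (Fin d)) n | g ^ p = 1} =
        Subgroup.map (QuotientGroup.mk' (lambdaP p (FreeGroup (Fin d)) n))
          (lambdaP p (FreeGroup (Fin d)) (n - 1)) := by
  have hΩ : ∀ g : FreeGroup (Fin d) ⧸ lambdaP p (FreeGroup (Fin d)) n, g ^ p = 1 →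
      ∃ x ∈ lambdaP p (FreeGroup (Fin d)) (n - 1), QuotientGroup.mk' _ x = g := by
    intro g hg
    induction g using QuotientGroup.induction_on with
    | H x =>
      refine ⟨x, FreeGroup.mem_lambdaP_of_pow_mem hp hodd ?_, rfl⟩
      rw [Nat.sub_add_cancel hn]
      exact (QuotientGroup.eq_one_iff (x ^ p)).1 hg
  refine ⟨?_, fun g => ?_, fun g hg => ?_, le_antisymm ?_ ?_⟩
  · have := finiteIndex_lambdaP hp.pos (G := FreeGroup (Fin d)) n
    infer_instance
  · induction g using QuotientGroup.induction_on with
    | H x =>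
      refine ⟨n, (QuotientGroup.eq_one_iff (x ^ p ^ n)).2 ?_⟩
      have := pow_pow_mem_lambdaP (p := p) (k := 0) (Subgroup.mem_top x) n
      rwa [zero_add] at this
  · obtain ⟨x, hx, rfl⟩ := hΩ g (orderOf_dvd_iff_pow_eq_one.1 hg.dvd)
    obtain ⟨m, rfl⟩ := Nat.exists_eq_succ_of_ne_zero hn.ne'
    exact Subgroup.mem_center_iff.2 fun q => (lambdaP_quotient_commute hx q).symm.eq
  · rw [Subgroup.closure_le]
    exact fun g hg => hΩ g hg
  · rintro _ ⟨x, hx, rfl⟩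
    refine Subgroup.subset_closure ((QuotientGroup.eq_one_iff (x ^ p)).2 ?_)
    have := pow_mem_lambdaP hx
    rwa [Nat.sub_add_cancel hn] at this
end

section
/- Let p be a prime, G a finite p-group, and A an abelian normal subgroup of G with C_G(C_G(A)) = A. If every automorphism of G of p-power order that acts trivially on C_G(A) and on G/A is inner, then Ĥ^1(G/C_G(A), A) = 0, where A is regarded as a G/C_G(A)-module via conjugation. -/
/-- Let `G` be a finite `p`-group and `A` an abelian normal subgroup with
`C_G(C_G(A)) = A`.  If every automorphism of `G` of `p`-power order acting
trivially on `C_G(A)` and on `G/A` is inner, then `Ĥ¹(G/C_G(A), A) = 0`: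
every derivation `δ : G/C_G(A) → A` (viewed as a derivation `G → A` for the
conjugation action which is trivial on `C_G(A)`) is an inner derivation
`x ↦ a⁻¹ * a^x` for some `a ∈ A`. -/
theorem h1_eq_zero_of_noninner_are_inner (p : ℕ) (hp : p.Prime)
    (G : Type*) [Group G] [Finite G] (hG : IsPGroup p G)
    (A : Subgroup G) [A.Normal]
    (hab : ∀ a ∈ A, ∀ b ∈ A, a * b = b * a)
    (hcc : Subgroup.centralizer
        ((Subgroup.centralizer (A : Set G) : Subgroup G) : Set G) = A)
    (hinn : ∀ θ : MulAut G, (∃ k : ℕ, orderOf θ = p ^ k) →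
      (∀ x ∈ Subgroup.centralizer (A : Set G), θ x = x) →
      (∀ x : G, x⁻¹ * θ x ∈ A) → ∃ g : G, θ = MulAut.conj g) :
    ∀ δ : G → G, (∀ x : G, δ x ∈ A) →
      (∀ x ∈ Subgroup.centralizer (A : Set G), δ x = 1) →
      (∀ x y : G, δ (x * y) = y⁻¹ * δ x * y * δ y) →
      ∃ a ∈ A, ∀ x : G, δ x = a⁻¹ * (x⁻¹ * a * x) := by
  intro δ hA hC hδ
  have A_le_centralizer : ∀ a ∈ A, a ∈ Subgroup.centralizer (A : Set G) := fun a ha =>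
    Subgroup.mem_centralizer_iff.2 fun b hb => hab b hb a ha
  let f : G →* G := MonoidHom.mk' (fun x => x * δ x) fun x y => by
    simp only [hδ]
    group
  have f_apply : ∀ x, f x = x * δ x := fun x => rfl
  have f_injective : Function.Injective f := by
    refine (injective_iff_map_eq_one f).2 fun x hx => ?_
    rw [f_apply] at hx
    have hxA : x ∈ A := by
      rw [eq_inv_of_mul_eq_one_left hx]
      exact A.inv_mem (hA x)
    rwa [hC x (A_le_centralizer x hxA), mul_one] at hx
  let θ : MulAut G := MulEquiv.ofBijective f (Finite.injective_iff_bijective.1 f_injective)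
  have θ_apply : ∀ x, θ x = x * δ x := fun x => rfl
  have θ_fixes : ∀ x ∈ Subgroup.centralizer (A : Set G), θ x = x := fun x hx => by
    rw [θ_apply, hC x hx, mul_one]
  have θ_pow_apply : ∀ (n : ℕ) (x : G), (θ ^ n) x = x * δ x ^ n := by
    intro n x
    induction n with
    | zero => simp
    | succ n ih =>
      rw [pow_succ', MulAut.mul_apply, ih, map_mul, map_pow, θ_apply x,
        θ_fixes (δ x) (A_le_centralizer _ (hA x)), mul_assoc, ← pow_succ']
  have θ_order : ∃ k : ℕ, orderOf θ = p ^ k := by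
    have : Fact p.Prime := ⟨hp⟩
    obtain ⟨m, hm⟩ := IsPGroup.iff_card.1 hG
    have θ_pow : θ ^ p ^ m = 1 := by
      ext x
      rw [θ_pow_apply, ← hm, pow_card_eq_one', mul_one, MulAut.one_apply]
    obtain ⟨k, -, hk⟩ := (Nat.dvd_prime_pow hp).1 (orderOf_dvd_of_pow_eq_one θ_pow)
    exact ⟨k, hk⟩
  obtain ⟨g, hg⟩ := hinn θ θ_order θ_fixes fun x => by
    rw [θ_apply, inv_mul_cancel_left]
    exact hA x
  have hgA : g ∈ A := by
    rw [← hcc, Subgroup.mem_centralizer_iff]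
    intro x hx
    have h := θ_fixes x hx
    rw [hg, MulAut.conj_apply, mul_inv_eq_iff_eq_mul] at h
    exact h.symm
  refine ⟨g, hgA, fun x => ?_⟩
  have h := θ_apply x
  rw [hg, MulAut.conj_apply] at h
  have conj_mem : x⁻¹ * g * x ∈ A := by
    simpa using Subgroup.Normal.conj_mem inferInstance g hgA x⁻¹
  rw [hab _ (A.inv_mem hgA) _ conj_mem, eq_comm, ← mul_right_inj x, ← h]
  group
end
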